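/- Let n ≥ 5 with n ≡ 1 (mod 4) and let P_n be the regular n-gon with unit circumradius. Then A(P_n) = n·tan(π/n) + (sin⁴(π/n)/cos²(π/n))·(((n+3)/4)·tan(2π/n) − tan(3π/(2n))). -/

import Mathlib

open MeasureTheory Real

noncomputable section

/-- The plane. -/
abbrev E2 := EuclideanSpace ℝ (Fin 2)

/-- The `k`-th vertex of the regular `n`-gon with unit circumradius. -/
def regVtx (n k : ℕ) : E2 :=
  (WithLp.equiv 2 (Fin 2 → ℝ)).symm ![Real.cos (2 * Real.pi * k / n), Real.sin (2 * Real.pi * k / n)]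

/-- The regular `n`-gon with unit circumradius. -/
def regPoly (n : ℕ) : Set E2 := convexHull ℝ (Set.range fun k : Fin n => regVtx n k)

/-- A convex polygon: the convex hull of a finite set of points. -/
def IsConvexPolygon (Q : Set E2) : Prop := ∃ F : Finset E2, Q = convexHull ℝ (F : Set E2)

/-- The supremum of the areas of convex polygons circumscribed about the regular `n`-gon. -/
def maxCircArea (n : ℕ) : ℝ :=
  sSup {A : ℝ | ∃ Q : Set E2, IsConvexPolygon Q ∧ regPoly n ⊆ Q ∧
    (∀ k : Fin n, regVtx n k ∈ frontier Q) ∧ (volume Q).toReal = A}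

/-- The quadratic objective in the normalised heights of the triangles erected on the edges. -/
def heightObj (n : ℕ) [NeZero n] (C : ℝ) (h : ZMod n → ℝ) : ℝ :=
  ∑ k, (2 * h k - 2 * C * h k ^ 2 - 2 * h k * h (k + 1))

section Objective

variable {n : ℕ} [NeZero n] {C : ℝ}

theorem sum_mul_add_one_eq (f g : ZMod n → ℝ) :
    ∑ k, f k * g (k + 1) = ∑ k, f (k - 1) * g k := by
  rw [← Equiv.sum_comp (Equiv.addRight (1 : ZMod n)) (fun k => f (k - 1) * g k)]
  simp

theorem heightObj_eq_symm (h : ZMod n → ℝ) :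
    heightObj n C h = ∑ k, h k * (2 - 2 * C * h k - h (k - 1) - h (k + 1)) := by
  have e := sum_mul_add_one_eq h h
  calc heightObj n C h
      = ∑ k, h k * (2 - 2 * C * h k - h (k + 1)) - ∑ k, h k * h (k + 1) := by
        rw [heightObj, ← Finset.sum_sub_distrib]
        exact Finset.sum_congr rfl fun k _ => by ring
    _ = _ := by
        rw [e, ← Finset.sum_sub_distrib]
        exact Finset.sum_congr rfl fun k _ => by ring

theorem heightObj_add_smul (h d : ZMod n → ℝ) (s : ℝ) :
    heightObj n C (fun k => h k + s * d k) = heightObj n C h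
      + s * ∑ k, d k * (2 - 4 * C * h k - 2 * h (k - 1) - 2 * h (k + 1))
      - s ^ 2 * ∑ k, d k * (2 * C * d k + d (k - 1) + d (k + 1)) := by
  have e := sum_mul_add_one_eq h d
  rw [heightObj_eq_symm, heightObj_eq_symm]
  have e' := sum_mul_add_one_eq d h
  have : ∑ k, (h k + s * d k) * (2 - 2 * C * (h k + s * d k) - (h (k - 1) + s * d (k - 1))
        - (h (k + 1) + s * d (k + 1)))
      = ∑ k, (h k * (2 - 2 * C * h k - h (k - 1) - h (k + 1))
          + s * (d k * (2 - 4 * C * h k - 2 * h (k - 1) - 2 * h (k + 1)))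
          - s ^ 2 * (d k * (2 * C * d k + d (k - 1) + d (k + 1)))
          + (s * (h (k - 1) * d k) - s * (h k * d (k + 1)))
          + (s * (d k * h (k + 1)) - s * (d (k - 1) * h k))) :=
    Finset.sum_congr rfl fun k _ => by ring
  rw [this]
  simp only [Finset.sum_add_distrib, Finset.sum_sub_distrib, ← Finset.mul_sum]
  rw [e, e']
  ring

theorem continuous_heightObj : Continuous (heightObj n C) := by
  unfold heightObj
  fun_prop

/-- `h` maximises the objective over the box `[0, 2 / C]ⁿ`, and lies below its upper faces. -/
def IsBoxMax (n : ℕ) [NeZero n] (C : ℝ) (h : ZMod n → ℝ) : Prop :=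
  (∀ k, 0 ≤ h k) ∧ (∀ k, h k < 2 / C) ∧
    ∀ h' : ZMod n → ℝ, (∀ k, 0 ≤ h' k ∧ h' k ≤ 2 / C) → heightObj n C h' ≤ heightObj n C h

theorem sum_single_quadratic (hn : 2 ≤ n) (k : ZMod n) (a : ℝ) :
    ∑ j, Pi.single (M := fun _ => ℝ) k a j * (2 * C * Pi.single (M := fun _ => ℝ) k a j
        + Pi.single (M := fun _ => ℝ) k a (j - 1) + Pi.single (M := fun _ => ℝ) k a (j + 1))
      = 2 * C * a ^ 2 := by
  have : Fact (1 < n) := ⟨hn⟩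
  rw [Finset.sum_eq_single k (fun j _ hj => by simp [hj]) (by simp)]
  simp
  ring

theorem sum_single_linear (h : ZMod n → ℝ) (k : ZMod n) (a : ℝ) :
    ∑ j, Pi.single (M := fun _ => ℝ) k a j * (2 - 4 * C * h j - 2 * h (j - 1) - 2 * h (j + 1))
      = a * (2 - 4 * C * h k - 2 * h (k - 1) - 2 * h (k + 1)) := by
  rw [Finset.sum_eq_single k (fun j _ hj => by simp [hj]) (by simp)]
  simp

theorem exists_isBoxMax (hn : 2 ≤ n) (hC : 0 < C) : ∃ h, IsBoxMax n C h := by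
  have hB : 0 < 2 / C := by positivity
  obtain ⟨h, hh, hmax⟩ := (isCompact_univ_pi fun _ : ZMod n => isCompact_Icc
    (a := (0 : ℝ)) (b := 2 / C)).exists_isMaxOn ⟨fun _ => 0, fun _ _ => ⟨le_rfl, hB.le⟩⟩
    continuous_heightObj.continuousOn
  have h0 : ∀ k, 0 ≤ h k := fun k => (hh k trivial).1
  refine ⟨h, h0, fun k => lt_of_le_of_ne (hh k trivial).2 fun hk => ?_,
    fun h' hh' => hmax fun k _ => hh' k⟩
  have hd : heightObj n C (fun j => h j + (-1) * Pi.single (M := fun _ => ℝ) k (2 / C) j)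
      ≤ heightObj n C h := by
    refine hmax fun j _ => ?_
    rcases eq_or_ne j k with rfl | hj
    · simp [hk, hB.le]
    · simpa [hj] using hh j trivial
  rw [heightObj_add_smul, sum_single_quadratic hn, sum_single_linear, hk] at hd
  have e : C * (2 / C) = 2 := by field_simp
  have e1 : 4 * C * (2 / C) = 8 := by linear_combination 4 * e
  have e2 : 2 * C * (2 / C) ^ 2 = 4 * (2 / C) := by linear_combination 2 * (2 / C) * e
  rw [e1, e2] at hd
  nlinarith [mul_nonneg hB.le (h0 (k - 1)), mul_nonneg hB.le (h0 (k + 1))]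

/-- First and second order conditions at a maximiser, along directions supported on its support. -/
theorem IsBoxMax.variation {h : ZMod n → ℝ} (hh : IsBoxMax n C h) (d : ZMod n → ℝ)
    (hd : ∀ k, d k ≠ 0 → 0 < h k) :
    ∑ k, d k * (2 - 4 * C * h k - 2 * h (k - 1) - 2 * h (k + 1)) = 0 ∧
      0 ≤ ∑ k, d k * (2 * C * d k + d (k - 1) + d (k + 1)) := by
  obtain ⟨h0, hB, hmax⟩ := hh
  set L := ∑ k, d k * (2 - 4 * C * h k - 2 * h (k - 1) - 2 * h (k + 1))
  set q := ∑ k, d k * (2 * C * d k + d (k - 1) + d (k + 1))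
  have hev : ∀ᶠ s : ℝ in nhds 0, s * L - s ^ 2 * q ≤ 0 := by
    have hbox : ∀ᶠ s : ℝ in nhds 0, ∀ k, 0 ≤ h k + s * d k ∧ h k + s * d k ≤ 2 / C := by
      refine Filter.eventually_all.2 fun k => ?_
      have hcont : Filter.Tendsto (fun s : ℝ => h k + s * d k) (nhds 0) (nhds (h k)) := by
        have : Continuous fun s : ℝ => h k + s * d k := by fun_prop
        simpa using this.tendsto 0
      refine Filter.Eventually.and ?_
        ((hcont.eventually_lt_const (hB k)).mono fun _ hs => hs.le)
      by_cases hk : d k = 0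
      · simp [hk, h0 k]
      · exact (hcont.eventually_const_lt (hd k hk)).mono fun _ hs => hs.le
    filter_upwards [hbox] with s hs
    have := hmax _ hs
    rw [heightObj_add_smul] at this
    linarith
  have hL : L = 0 := by
    have hloc : IsLocalMax (fun s : ℝ => s * L - s ^ 2 * q) 0 := by
      filter_upwards [hev] with s hs
      simpa using hs
    have hder : HasDerivAt (fun s : ℝ => s * L - s ^ 2 * q) L 0 := by
      have := ((hasDerivAt_id (0 : ℝ)).mul_const L).sub ((hasDerivAt_pow 2 (0 : ℝ)).mul_const q)
      exact this.congr_deriv (by simp)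
    exact hloc.hasDerivAt_eq_zero hder
  refine ⟨hL, ?_⟩
  obtain ⟨ε, hε, hball⟩ := Metric.eventually_nhds_iff.1 hev
  have := hball (y := ε / 2) (by simp [abs_of_pos hε, hε])
  rw [hL] at this
  have hε2 : 0 < (ε / 2) ^ 2 := by positivity
  by_contra! hq
  nlinarith

theorem IsBoxMax.stationary {h : ZMod n → ℝ} (hh : IsBoxMax n C h) {k : ZMod n}
    (hk : 0 < h k) : h (k - 1) + h (k + 1) + 2 * C * h k = 1 := by
  have := (hh.variation (Pi.single k 1) fun j hj => by
    rcases eq_or_ne j k with rfl | hjk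
    · exact hk
    · simp [hjk] at hj).1
  rw [sum_single_linear] at this
  linarith

theorem IsBoxMax.heightObj_eq_sum {h : ZMod n → ℝ} (hh : IsBoxMax n C h) :
    heightObj n C h = ∑ k, h k := by
  rw [heightObj_eq_symm]
  refine Finset.sum_congr rfl fun k _ => ?_
  rcases (hh.1 k).eq_or_lt with hk | hk
  · simp [← hk]
  · linear_combination (-h k) * hh.stationary hk

/-- A maximiser cannot be positive on a long run of consecutive indices. -/
theorem IsBoxMax.exists_zero {h : ZMod n → ℝ} (hh : IsBoxMax n (cos (2 * π / n)) h) {g : ℕ}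
    (hg : n < 2 * g) (hgn : g < n) (a : ZMod n) : ∃ i : ℕ, 0 < i ∧ i < g ∧ h (a + i) = 0 := by
  by_contra! hne
  have : Fact (1 < n) := ⟨by omega⟩
  set D : ℕ → ℝ := fun v => if v < g then (-1) ^ v * sin (π * v / g) else 0 with hD
  have hD0 : D 0 = 0 := by simp [hD]
  have hg0 : (0 : ℝ) < g := by exact_mod_cast (show 0 < g by omega)
  have hDlt : ∀ v, v ≤ g → D v = (-1) ^ v * sin (π * v / g) := fun v hv => by
    rcases hv.lt_or_eq with hv | rfl
    · simp [hD, hv]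
    · have : π * v / v = π := by field_simp
      simp [hD, this]
  have hq := (hh.variation (fun k => D (k - a).val) fun k hk => by
    refine lt_of_le_of_ne (hh.1 k) fun h0 => ?_
    by_cases hv : (k - a).val < g
    · refine hne (k - a).val (Nat.pos_of_ne_zero fun h => hk (by rw [h, hD0])) hv ?_
      simp [← h0]
    · exact hk (by simp [hD, hv])).2
  rw [← Equiv.sum_comp (Equiv.addRight a)] at hq
  simp only [Equiv.coe_addRight, add_sub_cancel_right, show ∀ x : ZMod n, x + a - 1 - a = x - 1
    from fun x => by ring, show ∀ x : ZMod n, x + a + 1 - a = x + 1 from fun x => by ring] at hq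
  have hang : π / g < 2 * π / n := by
    have : (n : ℝ) < 2 * g := by exact_mod_cast hg
    rw [div_lt_div_iff₀ hg0 (by exact_mod_cast (show 0 < n by omega))]
    nlinarith [pi_pos]
  have hcos : cos (2 * π / n) < cos (π / g) := by
    refine cos_lt_cos_of_nonneg_of_le_pi (by positivity) ?_ hang
    have : (2 : ℝ) ≤ n := by exact_mod_cast (show 2 ≤ n by omega)
    rw [div_le_iff₀ (by linarith)]
    nlinarith [pi_pos]
  have hterm : ∀ x : ZMod n, D x.val * (2 * cos (2 * π / n) * D x.val + D (x - 1).val + D (x + 1).val)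
      = 2 * (cos (2 * π / n) - cos (π / g)) * D x.val ^ 2 := by
    intro x
    by_cases hx0 : x.val = 0
    · simp [hx0, hD0]
    by_cases hxg : x.val < g
    · have e1 : (x + 1).val = x.val + 1 := by
        have := ZMod.val_add_of_lt (a := x) (b := 1) (by rw [ZMod.val_one]; omega)
        rwa [ZMod.val_one] at this
      have e2 : (x - 1).val = x.val - 1 := by
        have := ZMod.val_sub (a := x) (b := 1) (by rw [ZMod.val_one]; omega)
        rwa [ZMod.val_one] at this
      obtain ⟨v, hv⟩ := Nat.exists_eq_succ_of_ne_zero hx0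
      rw [e1, e2, hv, Nat.succ_eq_add_one, Nat.add_sub_cancel, hDlt _ (by omega), hDlt _ (by omega),
        hDlt _ (by omega)]
      have a1 : π * (v : ℕ) / g = π * (v + 1 : ℕ) / g - π / g := by push_cast; ring
      have a2 : π * (v + 1 + 1 : ℕ) / g = π * (v + 1 : ℕ) / g + π / g := by push_cast; ring
      rw [a1, a2, sin_sub, sin_add]
      ring
    · simp [hD, hxg]
  rw [Finset.sum_congr rfl fun x _ => hterm x, ← Finset.mul_sum] at hq
  have hpos : 0 < ∑ x : ZMod n, D x.val ^ 2 := by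
    refine Finset.sum_pos' (fun _ _ => sq_nonneg _) ⟨1, Finset.mem_univ _, ?_⟩
    rw [ZMod.val_one, hDlt _ (by omega)]
    have : 0 < sin (π * (1 : ℕ) / g) := by
      have hg2 : (2 : ℝ) ≤ g := by exact_mod_cast (show 2 ≤ g by omega)
      refine sin_pos_of_pos_of_lt_pi (by simp; positivity) ?_
      rw [div_lt_iff₀ hg0]
      push_cast
      nlinarith [pi_pos]
    rw [pow_one]
    positivity
  nlinarith

end Objective

section Gap

theorem recurrence_solution {t : ℝ} (hs : sin (2 * t) ≠ 0) (hc : cos t ≠ 0) {K : ℕ → ℝ} {g : ℕ}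
    (hK0 : K 0 = 0)
    (hK : ∀ i, 0 < i → i < g → K (i - 1) + K (i + 1) + 2 * cos (2 * t) * K i = 1) :
    ∃ x : ℝ, ∀ i ≤ g, K i = 1 / (4 * cos t ^ 2) * (1 - (-1) ^ i * cos (i * (2 * t)))
      + (-1) ^ i * x * sin (i * (2 * t)) := by
  set A := 1 / (4 * cos t ^ 2) with hA
  have hA1 : A * (2 + 2 * cos (2 * t)) = 1 := by
    rw [hA, cos_two_mul]; field_simp; ring
  refine ⟨(A * (1 + cos (2 * t)) - K 1) / sin (2 * t), fun i => ?_⟩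
  induction i using Nat.strong_induction_on with
  | _ i ih =>
    intro hi
    match i, ih, hi with
    | 0, _, _ => simp [hK0]
    | 1, _, _ => simp; field_simp; ring
    | i + 2, ih, hi =>
      have h1 := ih i (by omega) (by omega)
      have h2 := ih (i + 1) (by omega) (by omega)
      have h3 := hK (i + 1) (by omega) (by omega)
      rw [Nat.add_sub_cancel, h1, h2] at h3
      set x := (A * (1 + cos (2 * t)) - K 1) / sin (2 * t)
      have e1 : ((i : ℕ) : ℝ) * (2 * t) = ((i + 1 : ℕ) : ℝ) * (2 * t) - 2 * t := by push_cast; ring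
      have e2 : ((i + 2 : ℕ) : ℝ) * (2 * t) = ((i + 1 : ℕ) : ℝ) * (2 * t) + 2 * t := by
        push_cast; ring
      rw [e1, cos_sub, sin_sub] at h3
      rw [e2, cos_add, sin_add]
      rw [show i + 1 + 1 = i + 2 from rfl] at h3
      rw [pow_add] at h3 ⊢
      linear_combination h3 - hA1

theorem sum_of_recurrence {c : ℝ} {K : ℕ → ℝ} {g : ℕ} (hg : 0 < g) (hK0 : K 0 = 0)
    (hKg : K g = 0) (hK : ∀ i, 0 < i → i < g → K (i - 1) + K (i + 1) + 2 * c * K i = 1) :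
    (2 + 2 * c) * ∑ i ∈ Finset.range g, K i = g - 1 + K 1 + K (g - 1) := by
  obtain ⟨g, rfl⟩ := Nat.exists_eq_succ_of_ne_zero hg.ne'
  have h1 : ∑ i ∈ Finset.range g, (K i + K (i + 2) + 2 * c * K (i + 1)) = g := by
    rw [Finset.sum_congr rfl fun i hi => by
      simpa using hK (i + 1) (by omega) (by have := Finset.mem_range.1 hi; omega)]
    simp
  simp only [Finset.sum_add_distrib, ← Finset.mul_sum] at h1
  have a0 := Finset.sum_range_succ K g
  have a1 := Finset.sum_range_succ' K g
  have a2 := Finset.sum_range_succ (fun i => K (i + 1)) g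
  have a3 := Finset.sum_range_succ' (fun i => K (i + 1)) g
  simp only [Nat.succ_eq_add_one, Nat.add_sub_cancel, zero_add, show ∀ i, i + 1 + 1 = i + 2
    from fun _ => rfl] at *
  push_cast
  linear_combination h1 + a0 + a1 - a2 + a3 + 2 * c * a1 + (1 + 2 * c) * hK0 - hKg

/-- Total of a stationary gap of odd length. -/
theorem sum_gap_odd {t : ℝ} (ht : 0 < t) {K : ℕ → ℝ} {g : ℕ} (hg : Odd g) (hgt : g * t < π / 2)
    (ht4 : 4 * t < π) (hK0 : K 0 = 0) (hKg : K g = 0)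
    (hK : ∀ i, 0 < i → i < g → K (i - 1) + K (i + 1) + 2 * cos (2 * t) * K i = 1) :
    ∑ i ∈ Finset.range g, K i
      = 1 / (4 * cos t ^ 2) * (g - tan t * (cos (g * t) / sin (g * t))) := by
  have hg1 : (1 : ℝ) ≤ g := by exact_mod_cast hg.pos
  have hct : 0 < cos t := cos_pos_of_mem_Ioo ⟨by linarith, by linarith⟩
  have hs2 : 0 < sin (2 * t) := sin_pos_of_pos_of_lt_pi (by linarith) (by linarith)
  have hsg : 0 < sin (g * t) := sin_pos_of_pos_of_lt_pi (by positivity) (by linarith)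
  have hcg : 0 < cos (g * t) := cos_pos_of_mem_Ioo ⟨by nlinarith, hgt⟩
  obtain ⟨x, hx⟩ := recurrence_solution hs2.ne' hct.ne' hK0 hK
  have hsum := sum_of_recurrence hg.pos hK0 hKg hK
  have h1 := hx 1 hg.pos
  have h2 := hx (g - 1) (Nat.sub_le _ _)
  have h3 := hx g le_rfl
  have hodd : (-1 : ℝ) ^ g = -1 := hg.neg_one_pow
  have heven : (-1 : ℝ) ^ (g - 1) = 1 := (Nat.Odd.sub_odd hg odd_one).neg_one_pow
  have ecast : ((g - 1 : ℕ) : ℝ) * (2 * t) = 2 * (g * t) - 2 * t := by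
    rw [Nat.cast_sub hg.pos]; push_cast; ring
  have eg : (g : ℝ) * (2 * t) = 2 * (g * t) := by ring
  rw [hKg, hodd, eg, cos_two_mul, sin_two_mul] at h3
  have hxv : x = 1 / (4 * cos t ^ 2) * (cos (g * t) / sin (g * t)) := by
    have : x * sin (g * t) = 1 / (4 * cos t ^ 2) * cos (g * t) := by
      have : 2 * cos (g * t) * (x * sin (g * t)) =
          2 * cos (g * t) * (1 / (4 * cos t ^ 2) * cos (g * t)) := by linear_combination h3
      exact mul_left_cancel₀ (by positivity) this
    field_simp at this ⊢
    linear_combination this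
  set A := 1 / (4 * cos t ^ 2) with hA
  have hA' : 4 * cos t ^ 2 * A = 1 := by rw [hA]; field_simp
  set q := cos (g * t) / sin (g * t) with hq
  have hqs : q * sin (g * t) = cos (g * t) := by rw [hq]; field_simp
  rw [heven, ecast, cos_sub, sin_sub, hxv, cos_two_mul (g * t), sin_two_mul (g * t),
    cos_two_mul, sin_two_mul] at h2
  rw [hxv] at h1
  simp only [Nat.cast_one, one_mul, pow_one] at h1
  rw [cos_two_mul, sin_two_mul] at h1
  have h21 : K (g - 1) = K 1 := by
    rw [h1, h2]
    linear_combination A * (2 * cos (g * t) * (2 * cos t ^ 2 - 1)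
      + 2 * sin (g * t) * (2 * sin t * cos t)) * hqs
      - 2 * A * q * (2 * sin t * cos t) * sin_sq_add_cos_sq (g * t)
  have htan : tan t * cos t = sin t := tan_mul_cos hct.ne'
  rw [cos_two_mul, h21, h1] at hsum
  linear_combination A * hsum - (∑ i ∈ Finset.range g, K i + A * (tan t * q - 1)) * hA'
    + 4 * A ^ 2 * q * cos t * htan

/-- A stationary gap of even length on which the heights are positive has length two. -/
theorem even_gap_eq_two {t : ℝ} (ht : 0 < t) {K : ℕ → ℝ} {g : ℕ} (hg : Even g) (hg0 : 0 < g)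
    (hgt : g * t < π / 2) (ht4 : 4 * t < π) (hK0 : K 0 = 0) (hKg : K g = 0)
    (hpos : ∀ i, 0 < i → i < g → 0 < K i)
    (hK : ∀ i, 0 < i → i < g → K (i - 1) + K (i + 1) + 2 * cos (2 * t) * K i = 1) : g = 2 := by
  by_contra hne
  have hg4 : 4 ≤ g := by
    obtain ⟨m, rfl⟩ := hg
    omega
  have hg4' : (4 : ℝ) ≤ g := by exact_mod_cast hg4
  have hct : 0 < cos t := cos_pos_of_mem_Ioo ⟨by linarith, by linarith⟩
  have hs2 : 0 < sin (2 * t) := sin_pos_of_pos_of_lt_pi (by linarith) (by linarith)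
  have hsg : 0 < sin (g * t) := sin_pos_of_pos_of_lt_pi (by positivity) (by linarith)
  have hcg : 0 < cos (g * t) := cos_pos_of_mem_Ioo ⟨by nlinarith, hgt⟩
  obtain ⟨x, hx⟩ := recurrence_solution hs2.ne' hct.ne' hK0 hK
  have h2 := hx 2 (by omega)
  have h3 := hx g le_rfl
  have hp2 := hpos 2 (by omega) (by omega)
  have eg : (g : ℝ) * (2 * t) = 2 * (g * t) := by ring
  rw [hKg, hg.neg_one_pow, eg, cos_two_mul, sin_two_mul] at h3
  have hxv : x * cos (g * t) = - (1 / (4 * cos t ^ 2) * sin (g * t)) := by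
    have : 2 * sin (g * t) * (x * cos (g * t))
        = 2 * sin (g * t) * -(1 / (4 * cos t ^ 2) * sin (g * t)) := by
      linear_combination (-1) * h3 + 2 * (1 / (4 * cos t ^ 2)) * sin_sq_add_cos_sq (g * t)
    exact mul_left_cancel₀ (by positivity) this
  have e2 : K 2 * cos (g * t) = 1 / (4 * cos t ^ 2) * (cos (g * t) - cos (g * t - 4 * t)) := by
    rw [h2, cos_sub, show ((2 : ℕ) : ℝ) * (2 * t) = 4 * t by push_cast; ring]
    linear_combination sin (4 * t) * hxv
  have hle : cos (g * t) ≤ cos (g * t - 4 * t) :=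
    cos_le_cos_of_nonneg_of_le_pi (by nlinarith) (by linarith) (by linarith)
  have hA : 0 < 1 / (4 * cos t ^ 2) := by positivity
  nlinarith [mul_pos hp2 hcg]

end Gap

section Walk

theorem cot_add_tan_step {t x : ℝ} (ht : 0 < t) (hx : 0 < x) (hxt : 2 * x + 7 * t ≤ π) :
    -(cos x / sin x) + tan (2 * t) ≤ -(cos (x + 2 * t) / sin (x + 2 * t)) := by
  have hsx : 0 < sin x := sin_pos_of_pos_of_lt_pi hx (by linarith)
  have hsx2 : 0 < sin (x + 2 * t) := sin_pos_of_pos_of_lt_pi (by linarith) (by linarith)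
  have hc2 : 0 < cos (2 * t) := cos_pos_of_mem_Ioo ⟨by linarith, by linarith⟩
  have hs2 : 0 < sin (2 * t) := sin_pos_of_pos_of_lt_pi (by linarith) (by linarith)
  have h1 : cos (5 * t) ≤ cos (2 * t) :=
    cos_le_cos_of_nonneg_of_le_pi (by linarith) (by linarith) (by linarith)
  have h2 : cos (π - 5 * t) ≤ cos (2 * x + 2 * t) :=
    cos_le_cos_of_nonneg_of_le_pi (by linarith) (by linarith) (by linarith)
  rw [cos_pi_sub] at h2
  have hprod : sin x * sin (x + 2 * t) ≤ cos (2 * t) := by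
    have e : 2 * (sin x * sin (x + 2 * t)) = cos (2 * t) - cos (2 * x + 2 * t) := by
      have := two_mul_sin_mul_sin x (x + 2 * t)
      rw [show x - (x + 2 * t) = -(2 * t) by ring, cos_neg,
        show x + (x + 2 * t) = 2 * x + 2 * t by ring] at this
      linarith
    linarith
  have hdiff : cos x / sin x - cos (x + 2 * t) / sin (x + 2 * t)
      = sin (2 * t) / (sin x * sin (x + 2 * t)) := by
    have e : sin (2 * t) = sin (x + 2 * t) * cos x - cos (x + 2 * t) * sin x := by
      rw [← sin_sub]; congr 1; ring
    rw [e]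
    field_simp
  have : tan (2 * t) ≤ sin (2 * t) / (sin x * sin (x + 2 * t)) := by
    rw [tan_eq_sin_div_cos]
    gcongr
  linarith

theorem cot_add_tan_le {t : ℝ} (ht : 0 < t) {g : ℕ} (hg : 0 < g) (j : ℕ)
    (h : (2 * (g + 2 * j : ℕ) + 3) * t ≤ π) :
    -(cos (g * t) / sin (g * t)) - g / 2 * tan (2 * t)
      ≤ -(cos ((g + 2 * j : ℕ) * t) / sin ((g + 2 * j : ℕ) * t))
        - (g + 2 * j : ℕ) / 2 * tan (2 * t) := by
  induction j with
  | zero => simp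
  | succ j ih =>
    refine (ih (le_trans ?_ h)).trans ?_
    · gcongr; omega
    · have hg' : (0 : ℝ) < g := by exact_mod_cast hg
      have := cot_add_tan_step ht (x := (g + 2 * j : ℕ) * t) (by positivity)
        (le_trans (le_of_eq (by push_cast; ring)) h)
      have e : ((g + 2 * j : ℕ) : ℝ) * t + 2 * t = (g + 2 * (j + 1) : ℕ) * t := by push_cast; ring
      rw [e] at this
      push_cast at this ⊢
      linarith

theorem sum_gap_even {t : ℝ} (ht : 0 < t) {K : ℕ → ℝ} {g : ℕ} (hg : Even g) (hg0 : 0 < g)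
    (hgt : g * t < π / 2) (ht4 : 4 * t < π) (hK0 : K 0 = 0) (hKg : K g = 0)
    (hpos : ∀ i, 0 < i → i < g → 0 < K i)
    (hK : ∀ i, 0 < i → i < g → K (i - 1) + K (i + 1) + 2 * cos (2 * t) * K i = 1) :
    ∑ i ∈ Finset.range g, K i = 1 / (4 * cos t ^ 2) * (g + tan t * (g / 2 * tan (2 * t))) := by
  obtain rfl := even_gap_eq_two ht hg hg0 hgt ht4 hK0 hKg hpos hK
  have hct : 0 < cos t := cos_pos_of_mem_Ioo ⟨by linarith, by linarith⟩
  have hc2 : 0 < cos (2 * t) := cos_pos_of_mem_Ioo ⟨by linarith, by linarith⟩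
  have h1 := hK 1 (by omega) (by omega)
  norm_num [hK0, hKg] at h1
  have e : tan (2 * t) = 2 * sin t * cos t / cos (2 * t) := by
    rw [tan_eq_sin_div_cos, sin_two_mul]
  rw [Finset.sum_range_succ, Finset.sum_range_one, hK0, e, tan_eq_sin_div_cos]
  have : K 1 = 1 / (2 * cos (2 * t)) := by field_simp; linarith
  rw [this]
  push_cast
  field_simp
  rw [cos_two_mul]
  linear_combination (-4) * sin_sq_add_cos_sq t

theorem sum_le_of_zero {t M : ℝ} (ht : 0 < t) (ht4 : 4 * t < π) (hM0 : M ≤ 0)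
    (hM : ∀ g : ℕ, Odd g → g * t < π / 2 →
      -(cos (g * t) / sin (g * t)) ≤ g / 2 * tan (2 * t) + M)
    {H : ℕ → ℝ} (hH : ∀ i, 0 ≤ H i) (hH0 : H 0 = 0)
    (hcrit : ∀ i, 0 < H (i + 1) → H i + H (i + 2) + 2 * cos (2 * t) * H (i + 1) = 1)
    {N : ℕ} (hN : N * t < π / 2) (hrun : ∀ i, ∃ j, i < j ∧ j ≤ i + N ∧ H j = 0) (z : ℕ)
    (hz : H z = 0) :
    ∑ i ∈ Finset.range z, H i ≤ 1 / (4 * cos t ^ 2) *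
      (z + tan t * (z / 2 * tan (2 * t) + if Odd z then M else 0)) := by
  have hct : 0 < cos t := cos_pos_of_mem_Ioo ⟨by linarith, by linarith⟩
  have hT : 0 < tan t := tan_pos_of_pos_of_lt_pi_div_two ht (by linarith)
  induction z using Nat.strong_induction_on with
  | _ z ih =>
    rcases Nat.eq_zero_or_pos z with rfl | hz0
    · simp
    obtain ⟨y, hyz, hy, hmax⟩ : ∃ y < z, H y = 0 ∧ ∀ i, y < i → i < z → H i ≠ 0 := by
      classical
      refine ⟨Nat.findGreatest (fun i => H i = 0) (z - 1), ?_, ?_, fun i h1 h2 => ?_⟩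
      · have := Nat.findGreatest_le (P := fun i => H i = 0) (z - 1); omega
      · exact Nat.findGreatest_spec (P := fun i => H i = 0) (Nat.zero_le _) hH0
      · exact Nat.findGreatest_is_greatest h1 (by omega)
    obtain ⟨g, rfl⟩ := Nat.exists_eq_add_of_lt hyz
    rw [show y + g + 1 = y + (g + 1) by ring] at *
    generalize hgg : g + 1 = G at *
    have hG0 : 0 < G := by omega
    have hGN : G ≤ N := by
      obtain ⟨j, h1, h2, h3⟩ := hrun y
      by_contra hlt
      exact hmax j h1 (by omega) h3
    have hGt : G * t < π / 2 := by
      refine lt_of_le_of_lt ?_ hN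
      gcongr
    have hpos : ∀ i, 0 < i → i < G → 0 < H (y + i) := fun i h1 h2 =>
      lt_of_le_of_ne (hH _) (hmax _ (by omega) (by omega)).symm
    have hrec : ∀ i, 0 < i → i < G →
        H (y + (i - 1)) + H (y + (i + 1)) + 2 * cos (2 * t) * H (y + i) = 1 := by
      intro i h1 h2
      obtain ⟨i, rfl⟩ := Nat.exists_eq_succ_of_ne_zero h1.ne'
      exact hcrit (y + i) (hpos _ h1 h2)
    have hy' := ih y (by omega) hy
    rw [Finset.sum_range_add]
    rcases Nat.even_or_odd G with hG | hG
    · have hs := sum_gap_even (K := fun i => H (y + i)) ht hG hG0 hGt ht4 hy hz hpos hrec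
      have hpar : Odd (y + G) ↔ Odd y := by simp [Nat.odd_add, hG]
      simp only [hpar]
      rw [hs]
      refine (add_le_add_left hy' _).trans (le_of_eq ?_)
      push_cast
      ring
    · have hs := sum_gap_odd (K := fun i => H (y + i)) ht hG hGt ht4 hy hz hrec
      have hMG := hM G hG hGt
      have hb : ∑ i ∈ Finset.range G, H (y + i) ≤ 1 / (4 * cos t ^ 2) *
          (G + tan t * (G / 2 * tan (2 * t) + M)) := by
        rw [hs, sub_eq_add_neg, ← mul_neg]
        gcongr
      have hpar : Odd (y + G) ↔ ¬ Odd y := by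
        rw [Nat.odd_add, ← Nat.not_odd_iff_even]; tauto
      refine (add_le_add hy' hb).trans ?_
      rw [← mul_add]
      gcongr ?_ * ?_
      have hadd : (if Odd y then M else 0) + M ≤ if Odd (y + G) then M else 0 := by
        by_cases h : Odd y <;> (simp [hpar, h]; try linarith)
      have := mul_le_mul_of_nonneg_left hadd hT.le
      push_cast
      linarith

end Walk

/-- The maximal total of normalised heights. -/
def heightMax (n : ℕ) : ℝ :=
  1 / (4 * cos (π / n) ^ 2) *
    (n + tan (π / n) * (((n : ℝ) + 3) / 4 * tan (2 * (π / n)) - tan (3 * π / (2 * n))))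

section Cyclic

variable {n : ℕ}

theorem five_mul_pi_div_le (hn : 5 ≤ n) : 5 * (π / n) ≤ π := by
  have : (5 : ℝ) ≤ n := by exact_mod_cast hn
  rw [mul_div_assoc', div_le_iff₀ (by linarith)]
  nlinarith [pi_pos]

theorem pi_div_pos (hn : 5 ≤ n) : 0 < π / n := by
  have : (5 : ℝ) ≤ n := by exact_mod_cast hn
  have := pi_pos
  positivity

theorem gap_mul_pi_div {g : ℕ} (hn : 5 ≤ n) (hg : 2 * g + 3 = n) :
    g * (π / n) = π / 2 - 3 * π / (2 * n) := by
  have h : (2 * g + 3 : ℝ) = n := by exact_mod_cast hg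
  have : (n : ℝ) ≠ 0 := by positivity
  field_simp
  linarith

theorem heightMax_eq {g : ℕ} (hn : 5 ≤ n) (hg : 2 * g + 3 = n) :
    heightMax n = 1 / (4 * cos (π / n) ^ 2) * (n + tan (π / n) * (n / 2 * tan (2 * (π / n)) +
      (-(cos (g * (π / n)) / sin (g * (π / n))) - g / 2 * tan (2 * (π / n))))) := by
  have h : (2 * g + 3 : ℝ) = n := by exact_mod_cast hg
  rw [heightMax, gap_mul_pi_div hn hg, cos_pi_div_two_sub, sin_pi_div_two_sub,
    tan_eq_sin_div_cos (3 * π / (2 * n))]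
  have : (g : ℝ) = (n - 3) / 2 := by linarith
  rw [this]
  ring

theorem heightObj_le_heightMax [NeZero n] (hn : 5 ≤ n) (hmod : n % 4 = 1) {h : ZMod n → ℝ}
    (hh : ∀ k, 0 ≤ h k ∧ h k ≤ 2 / cos (2 * π / n)) :
    heightObj n (cos (2 * π / n)) h ≤ heightMax n := by
  have h5 := five_mul_pi_div_le hn
  have ht := pi_div_pos hn
  set t := π / n with htdef
  have hnt : n * t = π := by rw [htdef]; field_simp
  have e2 : 2 * π / n = 2 * t := by rw [htdef]; ring
  have hC : 0 < cos (2 * π / n) := by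
    rw [e2]; exact cos_pos_of_mem_Ioo ⟨by linarith, by linarith⟩
  obtain ⟨m, hm⟩ := exists_isBoxMax (n := n) (by omega) hC
  refine (hm.2.2 h hh).trans ?_
  rw [hm.heightObj_eq_sum]
  obtain ⟨q, hq⟩ : ∃ q, n = 4 * q + 5 := ⟨(n - 5) / 4, by omega⟩
  obtain ⟨g, hg⟩ : ∃ g, 2 * g + 3 = n := ⟨2 * q + 1, by omega⟩
  have hgR : (2 * g + 3 : ℝ) = n := by exact_mod_cast hg
  have hrun := fun a => hm.exists_zero (g := g + 2) (by omega) (by omega) a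
  obtain ⟨i₀, -, -, ha⟩ := hrun 0
  set a : ZMod n := 0 + i₀
  have hgt : g * t < π / 2 := by nlinarith
  have hsg : 0 < sin (g * t) := by
    have : (1 : ℝ) ≤ g := by exact_mod_cast (show 1 ≤ g by omega)
    exact sin_pos_of_pos_of_lt_pi (by positivity) (by linarith)
  have hcg : 0 < cos (g * t) := cos_pos_of_mem_Ioo ⟨by nlinarith, hgt⟩
  have ht2 : 0 < tan (2 * t) := tan_pos_of_pos_of_lt_pi_div_two (by linarith) (by linarith)
  have key := sum_le_of_zero (t := t)
    (M := -(cos (g * t) / sin (g * t)) - g / 2 * tan (2 * t)) ht (by linarith)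
    (by
      have := div_pos hcg hsg
      have : 0 ≤ g / 2 * tan (2 * t) := by positivity
      linarith)
    (by
      intro d hd hdt
      have hdn : 2 * d < n := by
        have : (2 * d : ℝ) < n := by
          by_contra! hle
          nlinarith
        exact_mod_cast this
      obtain ⟨j, hj⟩ : ∃ j, g = d + 2 * j := by
        obtain ⟨d', rfl⟩ := hd
        exact ⟨q - d', by omega⟩
      have := cot_add_tan_le ht hd.pos j (by rw [← hj, hgR, hnt])
      rw [← hj] at this
      linarith)
    (H := fun i => m (a + i)) (fun i => hm.1 _) (by simpa using ha)
    (fun i hi => by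
      have := hm.stationary hi
      rw [e2] at this
      push_cast at this ⊢
      rw [← this]
      ring_nf)
    (N := g + 1) (by push_cast; nlinarith)
    (fun i => by
      obtain ⟨j, h1, h2, h3⟩ := hrun (a + i)
      exact ⟨i + j, by omega, by omega, by rw [← h3]; push_cast; ring_nf⟩)
    n (by simpa using ha)
  have hodd : Odd n := by rw [Nat.odd_iff]; omega
  rw [if_pos hodd] at key
  rw [heightMax_eq hn hg]
  refine le_trans (le_of_eq ?_) key
  rw [← Equiv.sum_comp (Equiv.addLeft a) m]
  obtain ⟨n, rfl⟩ := Nat.exists_eq_succ_of_ne_zero (NeZero.ne n)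
  rw [← Fin.sum_univ_eq_sum_range (fun i => m (a + (i : ℕ)))]
  refine Finset.sum_congr rfl fun k _ => ?_
  have : ((Fin.val k : ℕ) : ZMod (n + 1)) = k := Fin.cast_val_eq_self k
  simp [this]

end Cyclic

section Extremal

/-- Heights of the extremal configuration: a long oscillating gap of length `g`,
followed by gaps of length two. -/
def extremalHeight (t : ℝ) (g i : ℕ) : ℝ :=
  if i ≤ g then
    1 / (4 * cos t ^ 2) * (1 + (-1) ^ i * sin (2 * (i * t) - g * t) / sin (g * t))
  else if Odd (i - g) then 1 / (2 * cos (2 * t)) else 0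

variable {t : ℝ} {g : ℕ}

theorem extremalHeight_zero (hs : sin (g * t) ≠ 0) : extremalHeight t g 0 = 0 := by
  simp [extremalHeight, hs]

theorem extremalHeight_self (hs : sin (g * t) ≠ 0) (hg : Odd g) : extremalHeight t g g = 0 := by
  simp only [extremalHeight, le_refl, if_true, hg.neg_one_pow]
  rw [show 2 * ((g : ℝ) * t) - g * t = g * t by ring]
  field_simp
  simp

theorem extremalHeight_of_even_sub (hs : sin (g * t) ≠ 0) (hg : Odd g) {i : ℕ} (hi : g ≤ i)
    (he : Even (i - g)) : extremalHeight t g i = 0 := by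
  rcases hi.eq_or_lt with rfl | hi
  · exact extremalHeight_self hs hg
  · simp [extremalHeight, hi.not_ge, he]

theorem extremalHeight_of_odd_sub {i : ℕ} (hi : g ≤ i) (ho : Odd (i - g)) :
    extremalHeight t g i = 1 / (2 * cos (2 * t)) := by
  have : g < i := lt_of_le_of_ne hi (by rintro rfl; simp at ho)
  simp [extremalHeight, this.not_ge, ho]

theorem extremalHeight_nonneg (ht : 0 < t) (hgt : g * t < π / 2) (hc2 : 0 < cos (2 * t)) (i : ℕ) :
    0 ≤ extremalHeight t g i := by
  unfold extremalHeight
  split_ifs with h1 h2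
  · have hi : (i : ℝ) * t ≤ g * t := by gcongr
    have hi0 : 0 ≤ (i : ℝ) * t := by positivity
    have hg0 : 0 ≤ sin (g * t) := sin_nonneg_of_nonneg_of_le_pi (by linarith) (by linarith)
    have hu : sin (2 * (i * t) - g * t) ≤ sin (g * t) :=
      sin_le_sin_of_le_of_le_pi_div_two (by linarith) hgt.le (by linarith)
    have hl : sin (-(g * t)) ≤ sin (2 * (i * t) - g * t) :=
      sin_le_sin_of_le_of_le_pi_div_two (by linarith) (by linarith) (by linarith)
    rw [sin_neg] at hl
    have : |(-1) ^ i * sin (2 * (i * t) - g * t) / sin (g * t)| ≤ 1 := by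
      rw [abs_div, abs_mul, abs_pow, abs_neg, abs_one, one_pow, one_mul, abs_of_nonneg hg0]
      exact div_le_one_of_le₀ (abs_le.2 ⟨hl, hu⟩) hg0
    have := (abs_le.1 this).1
    exact mul_nonneg (by positivity) (by linarith)
  · positivity
  · exact le_rfl

theorem extremalHeight_recurrence (hc : cos t ≠ 0) {i : ℕ} (hi : i + 2 ≤ g) :
    extremalHeight t g i + extremalHeight t g (i + 2)
      + 2 * cos (2 * t) * extremalHeight t g (i + 1) = 1 := by
  simp only [extremalHeight, show i ≤ g by omega, show i + 1 ≤ g by omega, hi, if_true]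
  have e1 : 2 * ((i : ℕ) * t) - g * t = 2 * ((i + 1 : ℕ) * t) - g * t - 2 * t := by push_cast; ring
  have e2 : 2 * ((i + 2 : ℕ) * t) - g * t = 2 * ((i + 1 : ℕ) * t) - g * t + 2 * t := by
    push_cast; ring
  rw [e1, e2, sin_sub (_ - _), sin_add]
  have hA : 1 / (4 * cos t ^ 2) * (2 + 2 * cos (2 * t)) = 1 := by
    rw [cos_two_mul]; field_simp; ring
  rw [pow_succ, pow_add]
  linear_combination hA

theorem extremalHeight_stationary (hc : cos t ≠ 0) (hc2 : 0 < cos (2 * t))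
    (hs : sin (g * t) ≠ 0) (hg : Odd g) {i : ℕ} (hi : 0 < extremalHeight t g (i + 1)) :
    extremalHeight t g i + extremalHeight t g (i + 2)
      + 2 * cos (2 * t) * extremalHeight t g (i + 1) = 1 := by
  rcases le_or_gt (i + 2) g with h | h
  · exact extremalHeight_recurrence hc h
  have hig : g ≤ i + 1 := by omega
  rcases Nat.even_or_odd (i + 1 - g) with he | ho
  · rw [extremalHeight_of_even_sub hs hg hig he] at hi
    exact absurd hi (lt_irrefl _)
  · have hgi : g ≤ i := by
      rcases hig.eq_or_lt with h | h
      · simp [h] at ho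
      · omega
    rw [extremalHeight_of_odd_sub hig ho, extremalHeight_of_even_sub hs hg hgi
      (by rw [Nat.odd_iff] at ho; rw [Nat.even_iff]; omega),
      extremalHeight_of_even_sub hs hg (show g ≤ i + 2 by omega)
      (by rw [Nat.odd_iff] at ho; rw [Nat.even_iff]; omega)]
    field_simp
    simp

theorem sum_extremalHeight_tail (hs : sin (g * t) ≠ 0) (hg : Odd g) (m : ℕ) :
    ∑ i ∈ Finset.range (g + 2 * m), extremalHeight t g i
      = ∑ i ∈ Finset.range g, extremalHeight t g i + m / (2 * cos (2 * t)) := by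
  induction m with
  | zero => simp
  | succ m ih =>
    rw [show g + 2 * (m + 1) = g + 2 * m + 1 + 1 by ring, Finset.sum_range_succ,
      Finset.sum_range_succ, ih, extremalHeight_of_even_sub hs hg (by omega)
      (by rw [Nat.even_iff]; omega), extremalHeight_of_odd_sub (by omega)
      (by rw [Nat.odd_iff]; omega)]
    push_cast
    ring

end Extremal

theorem exists_stationary_heights {n : ℕ} [NeZero n] (hn : 5 ≤ n) (hmod : n % 4 = 1) :
    ∃ h : ZMod n → ℝ, (∀ k, 0 ≤ h k) ∧
      (∀ k, 0 < h k → h (k - 1) + h (k + 1) + 2 * cos (2 * π / n) * h k = 1) ∧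
      ∑ k, h k = heightMax n := by
  have h5 := five_mul_pi_div_le hn
  have ht := pi_div_pos hn
  set t := π / n with htdef
  have hnt : n * t = π := by rw [htdef]; field_simp
  have e2 : 2 * π / n = 2 * t := by rw [htdef]; ring
  obtain ⟨q, hq⟩ : ∃ q, n = 4 * q + 5 := ⟨(n - 5) / 4, by omega⟩
  obtain ⟨g, hg⟩ : ∃ g, 2 * g + 3 = n := ⟨2 * q + 1, by omega⟩
  have hodd : Odd g := ⟨q, by omega⟩
  have hgR : (2 * g + 3 : ℝ) = n := by exact_mod_cast hg
  have hgt : g * t < π / 2 := by nlinarith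
  have hsg : sin (g * t) ≠ 0 := by
    have : (1 : ℝ) ≤ g := by exact_mod_cast hodd.pos
    exact (sin_pos_of_pos_of_lt_pi (by positivity) (by linarith)).ne'
  have hct : 0 < cos t := cos_pos_of_mem_Ioo ⟨by linarith, by linarith⟩
  have hc2 : 0 < cos (2 * t) := cos_pos_of_mem_Ioo ⟨by linarith, by linarith⟩
  have : Fact (1 < n) := ⟨by omega⟩
  have hnm : n = g + 2 * (q + 2) := by omega
  have hsucc : ∀ k : ZMod n, extremalHeight t g (k + 1).val = extremalHeight t g (k.val + 1) := by
    intro k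
    by_cases hk : k.val + 1 < n
    · have := ZMod.val_add_of_lt (a := k) (b := 1) (by rwa [ZMod.val_one])
      rw [this, ZMod.val_one]
    · have hk' : k.val + 1 = n := by have := ZMod.val_lt k; omega
      have : k + 1 = 0 := by
        rw [← ZMod.natCast_zmod_val k]
        exact_mod_cast (by rw [hk']; simp : ((k.val + 1 : ℕ) : ZMod n) = 0)
      rw [this, hk', ZMod.val_zero, extremalHeight_zero hsg,
        extremalHeight_of_even_sub hsg hodd (by omega) (by rw [Nat.even_iff]; omega)]
  refine ⟨fun k => extremalHeight t g k.val, fun k => extremalHeight_nonneg ht hgt hc2 _,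
    fun k hk => ?_, ?_⟩
  · beta_reduce at hk ⊢
    have hk0 : k.val ≠ 0 := fun h => by
      rw [h, extremalHeight_zero hsg] at hk
      exact lt_irrefl _ hk
    have hpred : (k - 1).val = k.val - 1 := by
      have := ZMod.val_sub (a := k) (b := 1) (by rw [ZMod.val_one]; omega)
      rwa [ZMod.val_one] at this
    obtain ⟨v, hv⟩ := Nat.exists_eq_succ_of_ne_zero hk0
    rw [hsucc, hpred, hv, e2]
    rw [hv] at hk
    exact extremalHeight_stationary hct.ne' hc2 hsg hodd hk
  · have h1 : ∑ k : ZMod n, extremalHeight t g k.val = ∑ i ∈ Finset.range n, extremalHeight t g i := by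
      obtain ⟨n, rfl⟩ := Nat.exists_eq_succ_of_ne_zero (NeZero.ne n)
      exact Fin.sum_univ_eq_sum_range (fun i => extremalHeight t g i) _
    have h2 := sum_extremalHeight_tail (t := t) hsg hodd (q + 2)
    rw [← hnm, sum_gap_odd ht hodd hgt (by linarith) (extremalHeight_zero hsg)
      (extremalHeight_self hsg hodd) (fun i hi hig => by
        obtain ⟨i, rfl⟩ := Nat.exists_eq_succ_of_ne_zero hi.ne'
        exact extremalHeight_recurrence hct.ne' (by omega))] at h2
    rw [h1, h2, heightMax_eq hn hg]
    have hqg : ((q + 2 : ℕ) : ℝ) = (n - g) / 2 := by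
      have : (n : ℝ) = g + 2 * (q + 2 : ℕ) := by exact_mod_cast hnm
      linarith
    have hd : 1 / (2 * cos (2 * t)) = 1 / (4 * cos t ^ 2) * (2 + tan t * tan (2 * t)) := by
      rw [tan_eq_sin_div_cos (2 * t), sin_two_mul, tan_eq_sin_div_cos]
      field_simp
      rw [cos_two_mul]
      linear_combination (-4) * sin_sq_add_cos_sq t
    rw [hqg, div_eq_mul_one_div _ (2 * cos (2 * t)), hd]
    ring

section Triangle

/-- The standard triangle with vertices `(0,0)`, `(1,0)`, `(0,1)`. -/
def stdTriangle : Set E2 := {p | 0 ≤ p 0 ∧ 0 ≤ p 1 ∧ p 0 + p 1 ≤ 1}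

theorem isClosed_stdTriangle : IsClosed stdTriangle := by
  have h0 : Continuous fun p : E2 => p 0 := by fun_prop
  have h1 : Continuous fun p : E2 => p 1 := by fun_prop
  exact (isClosed_le continuous_const h0).inter
    ((isClosed_le continuous_const h1).inter (isClosed_le (h0.add h1) continuous_const))

theorem isCompact_stdTriangle : IsCompact stdTriangle := by
  refine Metric.isCompact_of_isClosed_isBounded isClosed_stdTriangle ?_
  refine (Metric.isBounded_closedBall (x := (0 : E2)) (r := 2)).subset fun p hp => ?_
  obtain ⟨h0, h1, h2⟩ := hp
  rw [mem_closedBall_zero_iff, EuclideanSpace.norm_eq, Real.sqrt_le_left (by norm_num)]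
  simp only [Fin.sum_univ_two, Real.norm_eq_abs, sq_abs]
  nlinarith

theorem volume_stdTriangle : volume stdTriangle = ENNReal.ofReal (1 / 2) := by
  let T : Set (ℝ × ℝ) := {p | 0 ≤ p.1 ∧ 0 ≤ p.2 ∧ p.1 + p.2 ≤ 1}
  have hT : MeasurableSet T := by
    have : IsClosed T := (isClosed_le continuous_const continuous_fst).inter
      ((isClosed_le continuous_const continuous_snd).inter
        (isClosed_le (continuous_fst.add continuous_snd) continuous_const))
    exact this.measurableSet
  have e1 : volume stdTriangle = volume T := by
    have hp := (volume_preserving_finTwoArrow ℝ).comp (EuclideanSpace.volume_preserving_symm_measurableEquiv_toLp (Fin 2))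
    rw [← hp.measure_preimage hT.nullMeasurableSet]
    rfl
  rw [e1, Measure.volume_eq_prod, Measure.prod_apply hT]
  have hsec : ∀ x : ℝ, volume (Prod.mk x ⁻¹' T) =
      (Set.Icc (0 : ℝ) 1).indicator (fun x => ENNReal.ofReal (1 - x)) x := by
    intro x
    by_cases hx : x ∈ Set.Icc (0 : ℝ) 1
    · rw [Set.indicator_of_mem hx]
      have : Prod.mk x ⁻¹' T = Set.Icc 0 (1 - x) := by
        ext y
        simp only [T, Set.mem_preimage, Set.mem_ofPred_eq, Set.mem_Icc]
        constructor
        · rintro ⟨_, h1, h2⟩; exact ⟨h1, by linarith⟩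
        · rintro ⟨h1, h2⟩; exact ⟨hx.1, h1, by linarith⟩
      rw [this, Real.volume_Icc, sub_zero]
    · rw [Set.indicator_of_notMem hx]
      have : Prod.mk x ⁻¹' T = ∅ := by
        ext y
        simp only [T, Set.mem_preimage, Set.mem_ofPred_eq, Set.mem_empty_iff_false, iff_false]
        rintro ⟨h0, h1, h2⟩
        exact hx ⟨h0, by linarith⟩
      rw [this, measure_empty]
  rw [lintegral_congr hsec, lintegral_indicator measurableSet_Icc,
    ← ofReal_integral_eq_lintegral_ofReal]
  · rw [integral_Icc_eq_integral_Ioc, ← intervalIntegral.integral_of_le zero_le_one]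
    congr 1
    rw [intervalIntegral.integral_sub (by simp) (by simp)]
    norm_num [integral_id]
  · exact (by fun_prop : Continuous fun x : ℝ => 1 - x).continuousOn.integrableOn_Icc
  · filter_upwards [ae_restrict_mem measurableSet_Icc] with x hx
    simpa using hx.2

/-- The oriented area of the parallelogram spanned by two plane vectors. -/
def cross (u v : E2) : ℝ := u 0 * v 1 - u 1 * v 0

/-- The triangle with vertices `a`, `a + u` and `a + v`. -/
def triangle (a u v : E2) : Set E2 := (fun p : E2 => a + (p 0 • u + p 1 • v)) '' stdTriangle

theorem mem_triangle {a u v q : E2} :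
    q ∈ triangle a u v ↔ ∃ x y : ℝ, 0 ≤ x ∧ 0 ≤ y ∧ x + y ≤ 1 ∧ q = a + (x • u + y • v) := by
  constructor
  · rintro ⟨p, ⟨h0, h1, h2⟩, rfl⟩
    exact ⟨p 0, p 1, h0, h1, h2, rfl⟩
  · rintro ⟨x, y, h0, h1, h2, rfl⟩
    exact ⟨!₂[x, y], ⟨by simpa, by simpa, by simpa⟩, by simp⟩

theorem isCompact_triangle (a u v : E2) : IsCompact (triangle a u v) :=
  isCompact_stdTriangle.image (by fun_prop)

theorem volume_triangle (a u v : E2) :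
    volume (triangle a u v) = ENNReal.ofReal (|cross u v| / 2) := by
  let L : E2 →ₗ[ℝ] E2 := Matrix.toLin (EuclideanSpace.basisFun (Fin 2) ℝ).toBasis
    (EuclideanSpace.basisFun (Fin 2) ℝ).toBasis !![u 0, v 0; u 1, v 1]
  have hL : ∀ p, L p = p 0 • u + p 1 • v := by
    intro p
    ext i
    fin_cases i <;>
      simp [L, Matrix.toLin_apply, Matrix.mulVec, dotProduct, Fin.sum_univ_two] <;> ring
  have hdet : LinearMap.det L = cross u v := by
    rw [LinearMap.det_toLin, Matrix.det_fin_two_of, cross]; ring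
  have : triangle a u v = (fun q => a + q) '' (L '' stdTriangle) := by
    rw [Set.image_image]
    simp only [hL, triangle]
  rw [this, Set.image_add_left, measure_preimage_add, Measure.addHaar_image_linearMap, hdet,
    volume_stdTriangle, ← ENNReal.ofReal_mul (abs_nonneg _)]
  congr 1
  ring

theorem Convex.triangle_subset {Q : Set E2} (hQ : Convex ℝ Q) {a u v : E2} (ha : a ∈ Q)
    (hu : a + u ∈ Q) (hv : a + v ∈ Q) : triangle a u v ⊆ Q := by
  intro q hq
  obtain ⟨x, y, hx, hy, hxy, rfl⟩ := mem_triangle.1 hq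
  have := hQ.sum_mem (t := Finset.univ) (w := ![1 - x - y, x, y]) (z := ![a, a + u, a + v])
    (by intro i _; fin_cases i <;> simp <;> linarith) (by simp [Fin.sum_univ_three]; ring)
    (by intro i _; fin_cases i <;> simpa)
  simp only [Fin.sum_univ_three] at this
  convert this using 1
  simp
  module

/-- A line in the plane is a null set. -/
theorem volume_setOf_linearMap_eq {f : E2 →ₗ[ℝ] ℝ} (hf : f ≠ 0) (r : ℝ) :
    volume {q : E2 | f q = r} = 0 := by
  rcases Set.eq_empty_or_nonempty {q : E2 | f q = r} with h | ⟨p, hp⟩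
  · rw [h, measure_empty]
  · have : {q : E2 | f q = r} = (fun q => q + p) '' (LinearMap.ker f : Set E2) := by
      ext q
      simp only [Set.mem_ofPred_eq] at hp
      simp only [Set.image_add_right, Set.mem_preimage, SetLike.mem_coe, LinearMap.mem_ker,
        Set.mem_ofPred_eq, map_add, map_neg, hp]
      constructor <;> intro h <;> linarith
    rw [this, Set.image_add_right, measure_preimage_add_right]
    exact Measure.addHaar_submodule _ _ (mt LinearMap.ker_eq_top.1 hf)

end Triangle

section Vertices

variable {n : ℕ}

theorem cos_pi_div_pos (hn : 5 ≤ n) : 0 < cos (π / n) :=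
  cos_pos_of_mem_Ioo ⟨by linarith [pi_div_pos hn, pi_pos],
    by linarith [pi_div_pos hn, five_mul_pi_div_le hn]⟩

theorem cos_two_pi_div_pos (hn : 5 ≤ n) : 0 < cos (2 * π / n) := by
  rw [mul_div_assoc]
  exact cos_pos_of_mem_Ioo ⟨by linarith [pi_div_pos hn, pi_pos],
    by linarith [pi_div_pos hn, five_mul_pi_div_le hn]⟩

theorem cos_two_pi_div_lt_one (hn : 5 ≤ n) : cos (2 * π / n) < 1 := by
  rw [mul_div_assoc, ← cos_zero]
  exact cos_lt_cos_of_nonneg_of_le_pi le_rfl (by linarith [pi_div_pos hn, five_mul_pi_div_le hn])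
    (by linarith [pi_div_pos hn])

theorem sin_two_pi_div_pos (hn : 5 ≤ n) : 0 < sin (2 * π / n) := by
  rw [mul_div_assoc]
  exact sin_pos_of_pos_of_lt_pi (by linarith [pi_div_pos hn])
    (by linarith [pi_div_pos hn, five_mul_pi_div_le hn])

theorem ZMod.natCast_ne_zero_of_lt {a : ℕ} (h0 : a ≠ 0) (h : a < n) : (a : ZMod n) ≠ 0 := by
  rw [Ne, ZMod.natCast_eq_zero_iff]
  exact Nat.not_dvd_of_pos_of_lt (Nat.pos_of_ne_zero h0) h

theorem eq_smul_add_smul_of_cross_ne_zero {u v : E2} (h : cross u v ≠ 0) (q : E2) :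
    q = (cross q v / cross u v) • u + (cross u q / cross u v) • v := by
  ext i
  fin_cases i <;>
  · simp only [Fin.zero_eta, Fin.mk_one, PiLp.add_apply, PiLp.smul_apply, smul_eq_mul]
    field_simp
    simp only [cross]
    ring

variable [NeZero n]

/-- The vertices of the regular `n`-gon, indexed cyclically. -/
def vtx (k : ZMod n) : E2 := regVtx n k.val

/-- The linear form given by the unit normal of the side joining `vtx k` to `vtx (k + 1)`. -/
def sideForm (k : ZMod n) : E2 →ₗ[ℝ] ℝ :=
  cos ((2 * k.val + 1) * (π / n)) • (EuclideanSpace.proj (𝕜 := ℝ) (0 : Fin 2)).toLinearMap +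
    sin ((2 * k.val + 1) * (π / n)) • (EuclideanSpace.proj (𝕜 := ℝ) (1 : Fin 2)).toLinearMap

theorem val_intCast_mul_eq (m : ℤ) :
    ∃ j : ℤ, (2 * ((m : ZMod n).val : ℝ)) * (π / n) = 2 * m * (π / n) + j * (2 * π) := by
  have hn : (n : ℝ) ≠ 0 := by exact_mod_cast NeZero.ne n
  have h1 : (((m : ZMod n).val : ℤ) : ℝ) = ((m % n : ℤ) : ℝ) := by rw [ZMod.val_intCast]
  have h2 : (m : ℝ) = ((m % n : ℤ) : ℝ) + n * ((m / n : ℤ) : ℝ) := by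
    exact_mod_cast (Int.emod_add_mul_ediv m n).symm
  refine ⟨-(m / n), ?_⟩
  rw [Int.cast_natCast] at h1
  rw [h1, h2]
  push_cast
  field_simp
  ring

theorem vtx_intCast_zero (m : ℤ) : vtx (m : ZMod n) 0 = cos (2 * m * (π / n)) := by
  obtain ⟨j, hj⟩ := val_intCast_mul_eq (n := n) m
  rw [← cos_add_int_mul_two_pi _ j, ← hj]
  simp [vtx, regVtx]
  congr 1
  ring

theorem vtx_intCast_one (m : ℤ) : vtx (m : ZMod n) 1 = sin (2 * m * (π / n)) := by
  obtain ⟨j, hj⟩ := val_intCast_mul_eq (n := n) m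
  rw [← sin_add_int_mul_two_pi _ j, ← hj]
  simp [vtx, regVtx]
  congr 1
  ring

theorem sideForm_intCast (m : ℤ) (q : E2) : sideForm (m : ZMod n) q =
    cos ((2 * m + 1) * (π / n)) * q 0 + sin ((2 * m + 1) * (π / n)) * q 1 := by
  obtain ⟨j, hj⟩ := val_intCast_mul_eq (n := n) m
  have : (2 * ((m : ZMod n).val : ℝ) + 1) * (π / n) = (2 * m + 1) * (π / n) + j * (2 * π) := by
    linear_combination hj
  rw [sideForm, this, cos_add_int_mul_two_pi, sin_add_int_mul_two_pi]
  simp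

theorem vtx_sub_one_add_vtx_add_one (k : ZMod n) :
    vtx (k - 1) + vtx (k + 1) = (2 * cos (2 * π / n)) • vtx k := by
  obtain ⟨m, rfl⟩ := ZMod.intCast_surjective k
  have h1 : (m : ZMod n) - 1 = ((m - 1 : ℤ) : ZMod n) := by push_cast; rfl
  have h2 : (m : ZMod n) + 1 = ((m + 1 : ℤ) : ZMod n) := by push_cast; rfl
  have e1 : 2 * ((m : ℝ) - 1) * (π / n) = 2 * m * (π / n) - 2 * π / n := by ring
  have e2 : 2 * ((m : ℝ) + 1) * (π / n) = 2 * m * (π / n) + 2 * π / n := by ring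
  ext i
  rw [h1, h2]
  fin_cases i
  · simp only [Fin.zero_eta, PiLp.add_apply, PiLp.smul_apply, vtx_intCast_zero, smul_eq_mul]
    push_cast
    rw [e1, e2, cos_sub, cos_add]
    ring
  · simp only [Fin.mk_one, PiLp.add_apply, PiLp.smul_apply, vtx_intCast_one, smul_eq_mul]
    push_cast
    rw [e1, e2, sin_sub, sin_add]
    ring

theorem sum_vtx (hn : 5 ≤ n) : ∑ k : ZMod n, vtx k = 0 := by
  have h : ∑ k : ZMod n, (vtx (k - 1) + vtx (k + 1)) = ∑ k, (2 * cos (2 * π / n)) • vtx k :=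
    Finset.sum_congr rfl fun k _ => vtx_sub_one_add_vtx_add_one k
  have e1 : ∑ k : ZMod n, vtx (k - 1) = ∑ k : ZMod n, vtx k :=
    Equiv.sum_comp (Equiv.subRight (1 : ZMod n)) vtx
  have e2 : ∑ k : ZMod n, vtx (k + 1) = ∑ k : ZMod n, vtx k :=
    Equiv.sum_comp (Equiv.addRight (1 : ZMod n)) vtx
  rw [Finset.sum_add_distrib, ← Finset.smul_sum, e1, e2, ← two_smul ℝ, ← sub_eq_zero, ← sub_smul,
    smul_eq_zero] at h
  exact h.resolve_left (by linarith [cos_two_pi_div_lt_one hn] : 2 - 2 * cos (2 * π / n) > 0).ne'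

theorem cross_vtx (k : ZMod n) : cross (vtx k) (vtx (k + 1)) = sin (2 * π / n) := by
  obtain ⟨m, rfl⟩ := ZMod.intCast_surjective k
  have h2 : (m : ZMod n) + 1 = ((m + 1 : ℤ) : ZMod n) := by push_cast; rfl
  rw [h2, cross, vtx_intCast_zero, vtx_intCast_one, vtx_intCast_zero, vtx_intCast_one]
  rw [show 2 * π / n = 2 * ((m + 1 : ℤ) : ℝ) * (π / n) - 2 * m * (π / n) by push_cast; ring, sin_sub]
  ring

theorem sideForm_vtx (k j : ZMod n) :
    sideForm k (vtx j) = cos ((2 * (k - j).val + 1) * (π / n)) := by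
  obtain ⟨a, rfl⟩ := ZMod.intCast_surjective k
  obtain ⟨b, rfl⟩ := ZMod.intCast_surjective j
  rw [sideForm_intCast, vtx_intCast_zero, vtx_intCast_one, ← Int.cast_sub, ← cos_sub]
  obtain ⟨j, hj⟩ := val_intCast_mul_eq (n := n) (a - b)
  rw [← cos_add_int_mul_two_pi _ j]
  congr 1
  push_cast at hj ⊢
  linear_combination -hj

theorem sideForm_vtx_self (k : ZMod n) : sideForm k (vtx k) = cos (π / n) := by
  simp [sideForm_vtx]

theorem sideForm_vtx_add_one (k : ZMod n) : sideForm k (vtx (k + 1)) = cos (π / n) := by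
  obtain ⟨a, rfl⟩ := ZMod.intCast_surjective k
  have h2 : (a : ZMod n) + 1 = ((a + 1 : ℤ) : ZMod n) := by push_cast; rfl
  rw [h2, sideForm_intCast, vtx_intCast_zero, vtx_intCast_one, ← cos_sub, ← cos_neg]
  congr 1
  push_cast
  ring

theorem sideForm_vtx_le (hn : 5 ≤ n) {k j : ZMod n} (h0 : j ≠ k) (h1 : j ≠ k + 1) :
    sideForm k (vtx j) ≤ cos (π / n) * (2 * cos (2 * π / n) - 1) := by
  have ht := pi_div_pos hn
  have ht5 := five_mul_pi_div_le hn
  have e3 : cos (π / n) * (2 * cos (2 * π / n) - 1) = cos (3 * (π / n)) := by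
    rw [cos_three_mul, mul_div_assoc, cos_two_mul]; ring
  have hnt : n * (π / n) = π := by
    have : (n : ℝ) ≠ 0 := by exact_mod_cast NeZero.ne n
    field_simp
  rw [e3, sideForm_vtx]
  set m := (k - j).val with hm
  have hk : k - j = (m : ZMod n) := by rw [hm, ZMod.natCast_zmod_val]
  have hm0 : m ≠ 0 := fun h => h0 (by rw [h, Nat.cast_zero, sub_eq_zero] at hk; exact hk.symm)
  have hmn : m < n := ZMod.val_lt _
  have hm1 : m + 1 ≠ n := fun h => h1 (by
    have : ((m + 1 : ℕ) : ZMod n) = 0 := by rw [h, ZMod.natCast_self]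
    push_cast at this
    rw [← hk] at this
    linear_combination -this)
  have g1 : (1 : ℝ) ≤ m := by exact_mod_cast Nat.one_le_iff_ne_zero.2 hm0
  have g2 : (m : ℝ) + 2 ≤ n := by exact_mod_cast (by omega : m + 2 ≤ n)
  rcases le_total ((2 * (m : ℝ) + 1) * (π / n)) π with h | h
  · exact cos_le_cos_of_nonneg_of_le_pi (by positivity) h (by nlinarith)
  · rw [← cos_two_pi_sub]
    refine cos_le_cos_of_nonneg_of_le_pi (by positivity) (by linarith) ?_
    nlinarith

theorem sideForm_vtx_lt (hn : 5 ≤ n) {k j : ZMod n} (h0 : j ≠ k) (h1 : j ≠ k + 1) :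
    sideForm k (vtx j) < cos (π / n) :=
  (sideForm_vtx_le hn h0 h1).trans_lt (by
    nlinarith [cos_pi_div_pos hn, cos_two_pi_div_lt_one hn])

theorem sideForm_vtx_le_cos (hn : 5 ≤ n) (k j : ZMod n) : sideForm k (vtx j) ≤ cos (π / n) := by
  by_cases h0 : j = k
  · rw [h0, sideForm_vtx_self]
  by_cases h1 : j = k + 1
  · rw [h1, sideForm_vtx_add_one]
  exact (sideForm_vtx_lt hn h0 h1).le

theorem exists_eq_smul_vtx_add (hn : 5 ≤ n) (k : ZMod n) (q : E2) :
    ∃ a b : ℝ, q = a • vtx k + b • vtx (k + 1) := by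
  have hs := (sin_two_pi_div_pos hn).ne'
  rw [← cross_vtx k] at hs
  exact ⟨_, _, eq_smul_add_smul_of_cross_ne_zero hs q⟩

/-- The plane is covered by the closed sectors spanned by consecutive vertices. -/
theorem exists_sector (hn : 5 ≤ n) (q : E2) :
    ∃ (k : ZMod n) (a b : ℝ), 0 ≤ a ∧ 0 ≤ b ∧ q = a • vtx k + b • vtx (k + 1) := by
  obtain ⟨k, hk⟩ := Finite.exists_max fun k : ZMod n => sideForm k q
  obtain ⟨a, b, rfl⟩ := exists_eq_smul_vtx_add hn k q
  have h1 : (1 : ZMod n) ≠ 0 := by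
    simpa using ZMod.natCast_ne_zero_of_lt (n := n) one_ne_zero (by omega)
  have h2 : (2 : ZMod n) ≠ 0 := by
    simpa using ZMod.natCast_ne_zero_of_lt (n := n) two_ne_zero (by omega)
  refine ⟨k, a, b, ?_, ?_, rfl⟩
  · have h := hk (k + 1)
    have hlt : sideForm (k + 1) (vtx k) < cos (π / n) := sideForm_vtx_lt hn
      (fun h => h1 (by linear_combination -h)) (fun h => h2 (by linear_combination -h))
    simp only [map_add, map_smul, smul_eq_mul, sideForm_vtx_self, sideForm_vtx_add_one] at h
    nlinarith
  · have h := hk (k - 1)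
    have hlt : sideForm (k - 1) (vtx (k + 1)) < cos (π / n) := sideForm_vtx_lt hn
      (fun h => h2 (by linear_combination h)) (fun h => h1 (by linear_combination h))
    have e := sideForm_vtx_add_one (k - 1)
    rw [sub_add_cancel] at e
    simp only [map_add, map_smul, smul_eq_mul, sideForm_vtx_self, sideForm_vtx_add_one, e] at h
    nlinarith

theorem sideForm_sector_le (hn : 5 ≤ n) {a b : ℝ} (ha : 0 ≤ a) (hb : 0 ≤ b) (k l : ZMod n) :
    sideForm l (a • vtx k + b • vtx (k + 1)) ≤ sideForm k (a • vtx k + b • vtx (k + 1)) := by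
  simp only [map_add, map_smul, smul_eq_mul, sideForm_vtx_self, sideForm_vtx_add_one]
  gcongr <;> exact sideForm_vtx_le_cos hn _ _

theorem sideForm_injective (hn : 5 ≤ n) :
    Function.Injective (sideForm : ZMod n → E2 →ₗ[ℝ] ℝ) := by
  intro k l h
  have h2 : (2 : ZMod n) ≠ 0 := by
    simpa using ZMod.natCast_ne_zero_of_lt (n := n) two_ne_zero (by omega)
  have e1 := sideForm_vtx_self k
  have e2 := sideForm_vtx_add_one k
  rw [h] at e1 e2
  by_contra hkl
  have a1 : k = l + 1 := by
    by_contra hc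
    exact (sideForm_vtx_lt hn hkl hc).ne e1
  refine (sideForm_vtx_lt hn (fun hc => h2 ?_) (fun hc => hkl (add_right_cancel hc))).ne e2
  linear_combination hc - a1

end Vertices

section UpperBound

variable {n : ℕ}

/-- The relative height of the triangle cut out, above a side, by the supporting lines at its two
end points, in terms of the slacks of the supporting forms at the neighbouring vertices. -/
def slackHeight (C : ℝ) (P M : ZMod n → ℝ) (k : ZMod n) : ℝ :=
  if 0 < P k ∧ 0 < M (k + 1) then 1 / (M k / P k + P (k + 1) / M (k + 1) + 2 * C) else 0

section Slack

variable {C : ℝ} {P M : ZMod n → ℝ}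

theorem slackHeight_nonneg (hC : 0 < C) (hP : ∀ k, 0 ≤ P k) (hM : ∀ k, 0 ≤ M k) (k : ZMod n) :
    0 ≤ slackHeight C P M k := by
  unfold slackHeight
  split_ifs
  · have := div_nonneg (hM k) (hP k)
    have := div_nonneg (hP (k + 1)) (hM (k + 1))
    positivity
  · exact le_rfl

theorem slackHeight_le (hC : 0 < C) (hP : ∀ k, 0 ≤ P k) (hM : ∀ k, 0 ≤ M k) (k : ZMod n) :
    slackHeight C P M k ≤ 2 / C := by
  unfold slackHeight
  split_ifs
  · have h1 := div_nonneg (hM k) (hP k)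
    have h2 := div_nonneg (hP (k + 1)) (hM (k + 1))
    rw [div_le_div_iff₀ (by positivity) hC]
    linarith
  · positivity

theorem sum_slackHeight_le [NeZero n] (hC : 0 < C) (hP : ∀ k, 0 ≤ P k) (hM : ∀ k, 0 ≤ M k) :
    ∑ k, slackHeight C P M k ≤ heightObj n C (slackHeight C P M) := by
  set h := slackHeight C P M with hh
  have hstep : ∀ k, h k ≤ 2 * h k - 2 * C * h k ^ 2 - h k ^ 2 * (M k / P k)
      - h k ^ 2 * (P (k + 1) / M (k + 1)) := by
    intro k
    by_cases hc : 0 < P k ∧ 0 < M (k + 1)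
    · have h1 := div_nonneg (hM k) (hP k)
      have h2 := div_nonneg (hP (k + 1)) (hM (k + 1))
      have e : h k * (M k / P k + P (k + 1) / M (k + 1) + 2 * C) = 1 := by
        rw [hh, slackHeight, if_pos hc, one_div_mul_cancel]
        positivity
      nlinarith
    · have : h k = 0 := by rw [hh, slackHeight, if_neg hc]
      simp [this]
  have hamgm : ∀ k, 2 * h (k - 1) * h k ≤ h k ^ 2 * (M k / P k) + h (k - 1) ^ 2 * (P k / M k) := by
    intro k
    have h1 := div_nonneg (hM k) (hP k)
    have h2 := div_nonneg (hP k) (hM k)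
    by_cases hPk : P k = 0
    · have : h k = 0 := by rw [hh, slackHeight, if_neg (by simp [hPk])]
      rw [this]
      nlinarith [mul_nonneg (sq_nonneg (h (k - 1))) h2]
    by_cases hMk : M k = 0
    · have : h (k - 1) = 0 := by rw [hh, slackHeight, if_neg (by simp [hMk])]
      rw [this]
      nlinarith [mul_nonneg (sq_nonneg (h k)) h1]
    have hPp := lt_of_le_of_ne (hP k) (Ne.symm hPk)
    have hMp := lt_of_le_of_ne (hM k) (Ne.symm hMk)
    have e : h k ^ 2 * (M k / P k) + h (k - 1) ^ 2 * (P k / M k) - 2 * h (k - 1) * h k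
        = (h k * M k - h (k - 1) * P k) ^ 2 / (P k * M k) := by
      field_simp
      ring
    have : 0 ≤ (h k * M k - h (k - 1) * P k) ^ 2 / (P k * M k) := by positivity
    linarith
  calc ∑ k, h k ≤ ∑ k, (2 * h k - 2 * C * h k ^ 2 - h k ^ 2 * (M k / P k)
      - h k ^ 2 * (P (k + 1) / M (k + 1))) := Finset.sum_le_sum fun k _ => hstep k
    _ = ∑ k, (2 * h k - 2 * C * h k ^ 2)
        - ∑ k, (h k ^ 2 * (M k / P k) + h (k - 1) ^ 2 * (P k / M k)) := by
      rw [Finset.sum_add_distrib, ← sum_mul_add_one_eq (fun k => h k ^ 2) (fun k => P k / M k),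
        Finset.sum_sub_distrib, Finset.sum_sub_distrib]
      ring
    _ ≤ ∑ k, (2 * h k - 2 * C * h k ^ 2) - ∑ k, 2 * h (k - 1) * h k := by
      gcongr with k
      exact hamgm k
    _ = heightObj n C h := by
      have := sum_mul_add_one_eq (fun k => 2 * h k) h
      rw [heightObj, Finset.sum_sub_distrib (g := fun k => 2 * h k * h (k + 1)), this]

end Slack

/-- The triangle cut off above the side from `u` to `v` by two lines through `u` and `v`
contains every point satisfying the two corresponding linear inequalities. -/
theorem mem_triangle_of_slopes {u v : E2} {κ C μ ν a b : ℝ} (hκ : 0 < κ) (hC : 0 < C)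
    (hκC : κ = 2 * (1 - C)) (hμ : 0 ≤ μ) (hν : 0 ≤ ν) (hσ : 0 ≤ a + b - 1)
    (h1 : (a + b - 1) * (1 + μ) ≤ κ * b) (h2 : (a + b - 1) * (1 + ν) ≤ κ * a) :
    a • u + b • v ∈ triangle u (v - u)
      (((1 + ν) / (μ + ν + 2 * C) - 1) • u + ((1 + μ) / (μ + ν + 2 * C)) • v) := by
  set D := μ + ν + 2 * C with hD
  have hDp : 0 < D := by positivity
  have e1 : (a + b - 1) * D / κ * ((1 + μ) / D) = (a + b - 1) * (1 + μ) / κ := by field_simp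
  have e2 : (a + b - 1) * D / κ * ((1 + ν) / D) = (a + b - 1) * (1 + ν) / κ := by field_simp
  have e3 : (a + b - 1) * D / κ
      = (a + b - 1) * (1 + μ) / κ + (a + b - 1) * (1 + ν) / κ - (a + b - 1) := by
    have : D = (1 + μ) + (1 + ν) - κ := by rw [hD, hκC]; ring
    rw [this]
    field_simp
  refine mem_triangle.2 ⟨b - (a + b - 1) * (1 + μ) / κ, (a + b - 1) * D / κ, ?_, by positivity,
    ?_, ?_⟩
  · rw [sub_nonneg, div_le_iff₀ hκ]; linarith
  · have : (a + b - 1) * (1 + ν) / κ ≤ a := by rw [div_le_iff₀ hκ]; linarith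
    linarith
  · rw [smul_add, smul_smul, smul_smul, mul_sub, e1, e2, mul_one]
    have e4 : a = 1 - (b - (a + b - 1) * (1 + μ) / κ)
        + ((a + b - 1) * (1 + ν) / κ - (a + b - 1) * D / κ) := by rw [e3]; ring
    nth_rewrite 1 [e4]
    module

variable [NeZero n]

theorem volume_triangle_vtx (k : ZMod n) (hn : 5 ≤ n) :
    volume (triangle 0 (vtx k) (vtx (k + 1))) = ENNReal.ofReal (sin (2 * π / n) / 2) := by
  rw [volume_triangle, cross_vtx, abs_of_pos (sin_two_pi_div_pos hn)]

theorem volume_outer_triangle (hn : 5 ≤ n) (k : ZMod n) {a b : ℝ} (h : 0 ≤ a + b - 1) :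
    volume (triangle (vtx k) (vtx (k + 1) - vtx k) ((a - 1) • vtx k + b • vtx (k + 1))) =
      ENNReal.ofReal (sin (2 * π / n) / 2 * (a + b - 1)) := by
  have : cross (vtx (k + 1) - vtx k) ((a - 1) • vtx k + b • vtx (k + 1))
      = -((a + b - 1) * sin (2 * π / n)) := by
    rw [← cross_vtx k]
    simp [cross]
    ring
  rw [volume_triangle, this, abs_neg, abs_of_nonneg (mul_nonneg h (sin_two_pi_div_pos hn).le)]
  congr 1
  ring

theorem exists_outer_triangle (hn : 5 ≤ n) {Q : Set E2} (f : ZMod n → E2 →ₗ[ℝ] ℝ)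
    (hf : ∀ k, f k ≠ 0) (hfQ : ∀ k, ∀ q ∈ Q, f k q ≤ f k (vtx k)) (hV : ∀ k : ZMod n, vtx k ∈ Q)
    (k : ZMod n) :
    ∃ T : Set E2, volume T ≤ ENNReal.ofReal (sin (2 * π / n) / 2 *
        (2 * (1 - cos (2 * π / n)) * slackHeight (cos (2 * π / n))
          (fun k => f k (vtx k) - f k (vtx (k + 1)))
          (fun k => f k (vtx k) - f k (vtx (k - 1))) k)) ∧
      ∀ a b : ℝ, 0 ≤ a → 0 ≤ b → a • vtx k + b • vtx (k + 1) ∈ Q →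
        a • vtx k + b • vtx (k + 1) ∈ triangle 0 (vtx k) (vtx (k + 1)) ∪ T := by
  set C := cos (2 * π / n) with hCdef
  have hC : 0 < C := cos_two_pi_div_pos hn
  have hκ : 0 < 2 * (1 - C) := by linarith [cos_two_pi_div_lt_one hn]
  set P : ZMod n → ℝ := fun k => f k (vtx k) - f k (vtx (k + 1)) with hPdef
  set M : ZMod n → ℝ := fun k => f k (vtx k) - f k (vtx (k - 1)) with hMdef
  have hP : ∀ k, 0 ≤ P k := fun k => sub_nonneg.2 (hfQ k _ (hV _))
  have hM : ∀ k, 0 ≤ M k := fun k => sub_nonneg.2 (hfQ k _ (hV _))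
  have hPM : ∀ k, P k + M k = 2 * (1 - C) * f k (vtx k) := by
    intro k
    have := congrArg (f k) (vtx_sub_one_add_vtx_add_one k)
    simp only [map_add, map_smul, smul_eq_mul] at this
    simp only [hPdef, hMdef]
    linarith
  have hPMpos : ∀ k, 0 < P k + M k := by
    intro k
    refine lt_of_le_of_ne (add_nonneg (hP k) (hM k)) fun h0 => hf k ?_
    have hPk : P k = 0 := by linarith [hP k, hM k]
    have hv : f k (vtx k) = 0 := by
      have := hPM k
      rw [← h0] at this
      exact (mul_eq_zero.1 this.symm).resolve_left hκ.ne'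
    have hv' : f k (vtx (k + 1)) = 0 := by
      simp only [hPdef] at hPk
      linarith
    ext q
    obtain ⟨a, b, rfl⟩ := exists_eq_smul_vtx_add hn k q
    simp [hv, hv']
  have key : ∀ a b : ℝ, a • vtx k + b • vtx (k + 1) ∈ Q →
      (a + b - 1) * (P k + M k) ≤ 2 * (1 - C) * (b * P k) ∧
      (a + b - 1) * (P (k + 1) + M (k + 1)) ≤ 2 * (1 - C) * (a * M (k + 1)) := by
    intro a b hq
    have h1 := hfQ k _ hq
    have h2 := hfQ (k + 1) _ hq
    simp only [map_add, map_smul, smul_eq_mul] at h1 h2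
    have hPk : P k = f k (vtx k) - f k (vtx (k + 1)) := rfl
    have hMk : M (k + 1) = f (k + 1) (vtx (k + 1)) - f (k + 1) (vtx k) := by
      simp [hMdef]
    have g1 : (a + b - 1) * f k (vtx k) ≤ b * P k := by rw [hPk]; linarith
    have g2 : (a + b - 1) * f (k + 1) (vtx (k + 1)) ≤ a * M (k + 1) := by rw [hMk]; linarith
    rw [hPM, hPM, mul_left_comm, mul_left_comm (a + b - 1)]
    exact ⟨mul_le_mul_of_nonneg_left g1 hκ.le, mul_le_mul_of_nonneg_left g2 hκ.le⟩
  have inner : ∀ a b : ℝ, 0 ≤ a → 0 ≤ b → a + b - 1 ≤ 0 →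
      a • vtx k + b • vtx (k + 1) ∈ triangle 0 (vtx k) (vtx (k + 1)) := fun a b ha hb h =>
    mem_triangle.2 ⟨a, b, ha, hb, by linarith, by simp⟩
  by_cases hc : 0 < P k ∧ 0 < M (k + 1)
  · have hμ : 0 ≤ M k / P k := div_nonneg (hM k) (hP k)
    have hν : 0 ≤ P (k + 1) / M (k + 1) := div_nonneg (hP _) (hM _)
    have hs : slackHeight C P M k = 1 / (M k / P k + P (k + 1) / M (k + 1) + 2 * C) := by
      rw [slackHeight, if_pos hc]
    set μ := M k / P k with hμdef
    set ν := P (k + 1) / M (k + 1) with hνdef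
    have hsum : (1 + ν) / (μ + ν + 2 * C) + (1 + μ) / (μ + ν + 2 * C) - 1
        = 2 * (1 - C) * slackHeight C P M k := by
      rw [hs]
      have : 0 < μ + ν + 2 * C := by positivity
      field_simp
      ring
    refine ⟨_, (volume_outer_triangle hn k ?_).le.trans (by rw [hsum]), ?_⟩
    · rw [hsum]
      exact mul_nonneg hκ.le (slackHeight_nonneg hC hP hM k)
    · intro a b ha hb hq
      rcases le_total (a + b - 1) 0 with h | h
      · exact Or.inl (inner a b ha hb h)
      · right
        obtain ⟨h1, h2⟩ := key a b hq
        refine mem_triangle_of_slopes hκ hC rfl hμ hν h ?_ ?_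
        · rw [hμdef]
          have : 1 + M k / P k = (P k + M k) / P k := by have := hc.1.ne'; field_simp
          rw [this, ← mul_div_assoc, div_le_iff₀ hc.1]
          linarith
        · rw [hνdef]
          have : 1 + P (k + 1) / M (k + 1) = (P (k + 1) + M (k + 1)) / M (k + 1) := by
            have := hc.2.ne'; field_simp; ring
          rw [this, ← mul_div_assoc, div_le_iff₀ hc.2]
          linarith
  · refine ⟨∅, by simp, fun a b ha hb hq => Or.inl (inner a b ha hb ?_)⟩
    by_contra! h
    obtain ⟨h1, h2⟩ := key a b hq
    have h1' := (mul_pos h (hPMpos k)).trans_le h1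
    have h2' := (mul_pos h (hPMpos (k + 1))).trans_le h2
    refine hc ⟨lt_of_le_of_ne (hP k) fun h0 => ?_, lt_of_le_of_ne (hM _) fun h0 => ?_⟩
    · simp [← h0] at h1'
    · simp [← h0] at h2'

/-- The maximal area of a circumscribed polygon, expressed through `heightMax`. -/
def areaMax (n : ℕ) : ℝ :=
  sin (2 * π / n) / 2 * (n + 2 * (1 - cos (2 * π / n)) * heightMax n)

theorem volume_le_of_support (hn : 5 ≤ n) (hmod : n % 4 = 1) {Q : Set E2}
    (f : ZMod n → E2 →ₗ[ℝ] ℝ) (hf : ∀ k, f k ≠ 0) (hfQ : ∀ k, ∀ q ∈ Q, f k q ≤ f k (vtx k))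
    (hV : ∀ k : ZMod n, vtx k ∈ Q) : volume Q ≤ ENNReal.ofReal (areaMax n) := by
  choose T hTv hT using exists_outer_triangle hn f hf hfQ hV
  have hC : 0 < cos (2 * π / n) := cos_two_pi_div_pos hn
  have hκ : 0 < 2 * (1 - cos (2 * π / n)) := by linarith [cos_two_pi_div_lt_one hn]
  have hs := sin_two_pi_div_pos hn
  set P : ZMod n → ℝ := fun k => f k (vtx k) - f k (vtx (k + 1)) with hPdef
  set M : ZMod n → ℝ := fun k => f k (vtx k) - f k (vtx (k - 1)) with hMdef
  have hP : ∀ k, 0 ≤ P k := fun k => sub_nonneg.2 (hfQ k _ (hV _))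
  have hM : ∀ k, 0 ≤ M k := fun k => sub_nonneg.2 (hfQ k _ (hV _))
  have hh := slackHeight_nonneg hC hP hM
  have hcover : Q ⊆ ⋃ k : ZMod n, (triangle 0 (vtx k) (vtx (k + 1)) ∪ T k) := by
    intro q hq
    obtain ⟨k, a, b, ha, hb, rfl⟩ := exists_sector hn q
    exact Set.mem_iUnion.2 ⟨k, hT k a b ha hb hq⟩
  calc volume Q ≤ ∑ k : ZMod n, volume (triangle 0 (vtx k) (vtx (k + 1)) ∪ T k) :=
        (measure_mono hcover).trans (measure_iUnion_fintype_le _ _)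
    _ ≤ ∑ k : ZMod n, ENNReal.ofReal (sin (2 * π / n) / 2 * (1 + 2 * (1 - cos (2 * π / n)) *
          slackHeight (cos (2 * π / n)) P M k)) := by
        refine Finset.sum_le_sum fun k _ => ?_
        refine (measure_union_le _ _).trans ((add_le_add (volume_triangle_vtx k hn).le
          (hTv k)).trans ?_)
        rw [← ENNReal.ofReal_add (by positivity)
          (mul_nonneg (by positivity) (mul_nonneg hκ.le (hh k)))]
        apply le_of_eq
        congr 1
        ring
    _ = ENNReal.ofReal (sin (2 * π / n) / 2 * (n + 2 * (1 - cos (2 * π / n)) *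
          ∑ k, slackHeight (cos (2 * π / n)) P M k)) := by
        rw [← ENNReal.ofReal_sum_of_nonneg fun k _ => mul_nonneg (by positivity)
          (add_nonneg zero_le_one (mul_nonneg hκ.le (hh k))), ← Finset.mul_sum,
          Finset.sum_add_distrib, ← Finset.mul_sum]
        simp
    _ ≤ ENNReal.ofReal (areaMax n) := by
        refine ENNReal.ofReal_le_ofReal ?_
        unfold areaMax
        gcongr
        exact (sum_slackHeight_le hC hP hM).trans (heightObj_le_heightMax hn hmod fun k =>
          ⟨hh k, slackHeight_le hC hP hM k⟩)

theorem heightMax_nonneg (hn : 5 ≤ n) (hmod : n % 4 = 1) : 0 ≤ heightMax n := by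
  obtain ⟨h, h0, -, hsum⟩ := exists_stationary_heights hn hmod
  rw [← hsum]
  exact Finset.sum_nonneg fun k _ => h0 k

theorem volume_le_areaMax (hn : 5 ≤ n) (hmod : n % 4 = 1) {Q : Set E2} (hQ : Convex ℝ Q)
    (hV : ∀ k : ZMod n, vtx k ∈ Q) (hVQ : ∀ k : ZMod n, vtx k ∉ interior Q) :
    volume Q ≤ ENNReal.ofReal (areaMax n) := by
  rcases (interior Q).eq_empty_or_nonempty with hint | hint
  · have : volume Q = 0 := by
      refine measure_mono_null ?_ (hQ.addHaar_frontier volume)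
      rw [frontier, hint, Set.sdiff_empty]
      exact subset_closure
    simp [this]
  · choose f hf hfQ using fun k : ZMod n =>
      geometric_hahn_banach_of_nonempty_interior_point hQ (hVQ k) hint
    refine volume_le_of_support hn hmod (fun k => (f k : E2 →ₗ[ℝ] ℝ)) (fun k h => hf k ?_) hfQ hV
    ext q
    exact LinearMap.congr_fun h q

end UpperBound

section LowerBound

variable {n : ℕ}

theorem notMem_interior_of_forall_le {Q : Set E2} {f : E2 →ₗ[ℝ] ℝ} {v : E2} (hv : 0 < f v)
    (hf : ∀ q ∈ Q, f q ≤ f v) : v ∉ interior Q := by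
  intro hint
  have hcont : ContinuousAt (fun s : ℝ => s • v) 1 := by fun_prop
  have hev : ∀ᶠ s : ℝ in nhds 1, s • v ∈ Q :=
    hcont.eventually_mem (by simpa using mem_interior_iff_mem_nhds.1 hint)
  obtain ⟨s, hs, hs1⟩ := ((hev.filter_mono nhdsWithin_le_nhds).and
    (self_mem_nhdsWithin : Set.Ioi (1 : ℝ) ∈ nhdsWithin 1 (Set.Ioi 1))).exists
  have := hf _ hs
  rw [map_smul, smul_eq_mul] at this
  have : 1 < s := hs1
  nlinarith

/-- The apex erected over the side from `vtx k` to `vtx (k + 1)` by the heights `h`. It is the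
vertex `vtx k` itself if `h k = 0`. -/
def apex (h : ZMod n → ℝ) (k : ZMod n) : E2 :=
  if h k = 0 then vtx k
  else (h k + h (k + 1)) • vtx k + (h k + h (k - 1)) • vtx (k + 1)

section Apex

variable {h : ZMod n → ℝ} (h0 : ∀ k, 0 ≤ h k)
  (hst : ∀ k, 0 < h k → h (k - 1) + h (k + 1) + 2 * cos (2 * π / n) * h k = 1)

include h0 hst

theorem apex_eq_smul_add_smul (k : ZMod n) : ∃ a b : ℝ, 0 ≤ a ∧ 0 ≤ b ∧
    a + b - 1 = 2 * (1 - cos (2 * π / n)) * h k ∧ apex h k = a • vtx k + b • vtx (k + 1) := by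
  by_cases hk : h k = 0
  · exact ⟨1, 0, by simp, by simp, by simp [hk], by simp [apex, hk]⟩
  · refine ⟨h k + h (k + 1), h k + h (k - 1), add_nonneg (h0 _) (h0 _), add_nonneg (h0 _) (h0 _),
      ?_, by simp [apex, hk]⟩
    have := hst k (lt_of_le_of_ne (h0 k) (Ne.symm hk))
    linear_combination this

variable [NeZero n]

theorem sideForm_apex_self (k : ZMod n) : sideForm k (apex h k) =
    cos (π / n) + 2 * (1 - cos (2 * π / n)) * cos (π / n) * h k := by
  obtain ⟨a, b, -, -, hab, e⟩ := apex_eq_smul_add_smul h0 hst k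
  simp only [e, map_add, map_smul, smul_eq_mul, sideForm_vtx_self, sideForm_vtx_add_one]
  linear_combination cos (π / n) * hab

theorem sideForm_apex_le (hn : 5 ≤ n) {i k : ZMod n} (hik : i ≠ k) :
    sideForm i (apex h k) ≤ cos (π / n) := by
  have hc := cos_pi_div_pos hn
  have hC := cos_two_pi_div_pos hn
  have hC1 := cos_two_pi_div_lt_one hn
  by_cases hk : h k = 0
  · rw [apex, if_pos hk]
    exact sideForm_vtx_le_cos hn i k
  have hkp := lt_of_le_of_ne (h0 k) (Ne.symm hk)
  have hs := hst k hkp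
  rw [apex, if_neg hk]
  simp only [map_add, map_smul, smul_eq_mul]
  have a0 : 0 ≤ h k + h (k + 1) := add_nonneg (h0 _) (h0 _)
  have b0 : 0 ≤ h k + h (k - 1) := add_nonneg (h0 _) (h0 _)
  have hκ : 0 ≤ cos (π / n) * (1 - cos (2 * π / n)) := mul_nonneg hc.le (by linarith)
  by_cases h1 : i = k + 1
  · have := sideForm_vtx_le hn (k := i) (j := k) (Ne.symm hik) (fun e => ?_)
    · rw [h1] at this ⊢
      rw [sideForm_vtx_self]
      have := mul_le_mul_of_nonneg_left this a0
      nlinarith [mul_nonneg hκ (h0 (k + 1))]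
    · rw [h1] at e
      exact ZMod.natCast_ne_zero_of_lt (n := n) two_ne_zero (by omega)
        (by push_cast; linear_combination -e)
  by_cases h2 : k = i + 1
  · have hk1 : i = k - 1 := by rw [h2]; ring
    have := sideForm_vtx_le hn (k := i) (j := k + 1) (fun e => ?_) (fun e => ?_)
    · have e := sideForm_vtx_add_one i
      rw [← h2] at e
      rw [e]
      have := mul_le_mul_of_nonneg_left this b0
      nlinarith [mul_nonneg hκ (h0 (k - 1))]
    · rw [← e] at h2
      exact ZMod.natCast_ne_zero_of_lt (n := n) two_ne_zero (by omega)
        (by push_cast; linear_combination -h2)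
    · exact hik (add_right_cancel e).symm
  · have v1 := sideForm_vtx_le hn (k := i) (j := k) (Ne.symm hik) h2
    have v2 := sideForm_vtx_le hn (k := i) (j := k + 1) (Ne.symm h1)
      (fun e => hik (add_right_cancel e).symm)
    have w1 := mul_le_mul_of_nonneg_left v1 a0
    have w2 := mul_le_mul_of_nonneg_left v2 b0
    have hh : 2 * cos (2 * π / n) * h k ≤ 1 := by linarith [h0 (k - 1), h0 (k + 1)]
    have hh' : 0 ≤ 1 - (2 * cos (2 * π / n) - 1) * h k := by linarith
    have e : h k + h (k + 1) + (h k + h (k - 1)) = 1 + 2 * (1 - cos (2 * π / n)) * h k := by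
      linear_combination hs
    calc _ ≤ (h k + h (k + 1) + (h k + h (k - 1)))
            * (cos (π / n) * (2 * cos (2 * π / n) - 1)) := by linarith
      _ = cos (π / n) - 2 * (cos (π / n) * (1 - cos (2 * π / n))) *
            (1 - (2 * cos (2 * π / n) - 1) * h k) := by rw [e]; ring
      _ ≤ cos (π / n) := by nlinarith [mul_nonneg hκ hh']

theorem sideForm_add_one_apex_le (hn : 5 ≤ n) {k : ZMod n} (hk : 0 < h k) :
    sideForm (k + 1) (apex h k) ≤
      cos (π / n) - 2 * (1 - cos (2 * π / n)) * cos (π / n) * h (k + 1) := by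
  have hs := hst k hk
  have a0 : 0 ≤ h k + h (k + 1) := add_nonneg (h0 _) (h0 _)
  rw [apex, if_neg hk.ne']
  simp only [map_add, map_smul, smul_eq_mul, sideForm_vtx_self]
  have := sideForm_vtx_le hn (k := k + 1) (j := k)
    (fun e => ZMod.natCast_ne_zero_of_lt (n := n) one_ne_zero (by omega)
        (by push_cast; linear_combination -e))
    (fun e => ZMod.natCast_ne_zero_of_lt (n := n) two_ne_zero (by omega)
        (by push_cast; linear_combination -e))
  have := mul_le_mul_of_nonneg_left this a0
  have e : h (k - 1) = 1 - h (k + 1) - 2 * cos (2 * π / n) * h k := by linarith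
  rw [e]
  linarith

theorem sideForm_sub_one_apex_le (hn : 5 ≤ n) {k : ZMod n} (hk : 0 < h k) :
    sideForm (k - 1) (apex h k) ≤
      cos (π / n) - 2 * (1 - cos (2 * π / n)) * cos (π / n) * h (k - 1) := by
  have hs := hst k hk
  have b0 : 0 ≤ h k + h (k - 1) := add_nonneg (h0 _) (h0 _)
  have e1 := sideForm_vtx_add_one (k - 1)
  rw [sub_add_cancel] at e1
  rw [apex, if_neg hk.ne']
  simp only [map_add, map_smul, smul_eq_mul, e1]
  have := sideForm_vtx_le hn (k := k - 1) (j := k + 1)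
    (fun e => ZMod.natCast_ne_zero_of_lt (n := n) two_ne_zero (by omega)
        (by push_cast; linear_combination e))
    (fun e => ZMod.natCast_ne_zero_of_lt (n := n) one_ne_zero (by omega)
        (by push_cast; linear_combination e))
  have := mul_le_mul_of_nonneg_left this b0
  have e : h (k + 1) = 1 - h (k - 1) - 2 * cos (2 * π / n) * h k := by linarith
  rw [e]
  linarith

/-- The polygon spanned by the regular polygon and the apexes has a supporting line at each
vertex of the regular polygon. -/
theorem exists_support (hn : 5 ≤ n) (m : ZMod n) : ∃ f : E2 →ₗ[ℝ] ℝ, 0 < f (vtx m) ∧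
    (∀ j : ZMod n, f (vtx j) ≤ f (vtx m)) ∧ ∀ j, f (apex h j) ≤ f (vtx m) := by
  have hc := cos_pi_div_pos hn
  have hκ : 0 ≤ 2 * (1 - cos (2 * π / n)) * cos (π / n) :=
    mul_nonneg (by linarith [cos_two_pi_div_lt_one hn]) hc.le
  have em := sideForm_vtx_add_one (m - 1)
  rw [sub_add_cancel] at em
  by_cases hz : h m = 0 ∧ h (m - 1) = 0
  · refine ⟨sideForm m, ?_, fun j => ?_, fun j => ?_⟩
    · rwa [sideForm_vtx_self]
    · rw [sideForm_vtx_self]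
      exact sideForm_vtx_le_cos hn m j
    · rw [sideForm_vtx_self]
      by_cases hj : m = j
      · rw [← hj, apex, if_pos hz.1, sideForm_vtx_self]
      · exact sideForm_apex_le h0 hst hn hj
  · have hpos : 0 < h m + h (m - 1) := by
      refine lt_of_le_of_ne (add_nonneg (h0 _) (h0 _)) fun e => hz ?_
      constructor <;> linarith [h0 m, h0 (m - 1)]
    refine ⟨h m • sideForm (m - 1) + h (m - 1) • sideForm m, ?_, fun j => ?_, fun j => ?_⟩ <;>
      simp only [LinearMap.add_apply, LinearMap.smul_apply, smul_eq_mul, em, sideForm_vtx_self]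
    · nlinarith
    · exact add_le_add (mul_le_mul_of_nonneg_left (sideForm_vtx_le_cos hn _ _) (h0 _))
        (mul_le_mul_of_nonneg_left (sideForm_vtx_le_cos hn _ _) (h0 _))
    · by_cases hj : j = m
      · subst hj
        by_cases hjz : h j = 0
        · rw [apex, if_pos hjz, sideForm_vtx_self, em]
        have hjp := lt_of_le_of_ne (h0 j) (Ne.symm hjz)
        have i1 := mul_le_mul_of_nonneg_left (sideForm_sub_one_apex_le h0 hst hn hjp) hjp.le
        rw [sideForm_apex_self h0 hst]
        linarith
      by_cases hj' : j = m - 1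
      · have ej : m = j + 1 := by rw [hj']; ring
        subst ej
        rw [add_sub_cancel_right]
        by_cases hjz : h j = 0
        · rw [hjz, apex, if_pos hjz, sideForm_vtx_self]
          linarith
        have hjp := lt_of_le_of_ne (h0 j) (Ne.symm hjz)
        have i1 := mul_le_mul_of_nonneg_left (sideForm_add_one_apex_le h0 hst hn hjp) hjp.le
        rw [sideForm_apex_self h0 hst]
        linarith
      · exact add_le_add
          (mul_le_mul_of_nonneg_left (sideForm_apex_le h0 hst hn (Ne.symm hj')) (h0 _))
          (mul_le_mul_of_nonneg_left (sideForm_apex_le h0 hst hn (Ne.symm hj)) (h0 _))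

theorem le_volume_of_apex_mem (hn : 5 ≤ n) {Q : Set E2} (hQ : Convex ℝ Q) (hQ0 : 0 ∈ Q)
    (hV : ∀ k : ZMod n, vtx k ∈ Q) (hA : ∀ k, apex h k ∈ Q) :
    ENNReal.ofReal (sin (2 * π / n) / 2 * (n + 2 * (1 - cos (2 * π / n)) * ∑ k, h k)) ≤
      volume Q := by
  have hc := cos_pi_div_pos hn
  have hs := sin_two_pi_div_pos hn
  have hκ : 0 ≤ 2 * (1 - cos (2 * π / n)) := by linarith [cos_two_pi_div_lt_one hn]
  choose a b ha hb hab hap using apex_eq_smul_add_smul h0 hst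
  have hab0 : ∀ k, 0 ≤ a k + b k - 1 := fun k => by
    rw [hab]; exact mul_nonneg hκ (h0 k)
  set T₀ : ZMod n → Set E2 := fun k => triangle 0 (vtx k) (vtx (k + 1))
  set T₁ : ZMod n → Set E2 := fun k =>
    triangle (vtx k) (vtx (k + 1) - vtx k) ((a k - 1) • vtx k + b k • vtx (k + 1))
  have hform₀ : ∀ k, ∀ q ∈ T₀ k, ∃ x y : ℝ, 0 ≤ x ∧ 0 ≤ y ∧ x + y ≤ 1 ∧
      q = x • vtx k + y • vtx (k + 1) := by
    intro k q hq
    obtain ⟨x, y, hx, hy, hxy, rfl⟩ := mem_triangle.1 hq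
    exact ⟨x, y, hx, hy, hxy, by simp⟩
  have hform₁ : ∀ k, ∀ q ∈ T₁ k, ∃ x y : ℝ, 0 ≤ x ∧ 0 ≤ y ∧ 1 ≤ x + y ∧
      q = x • vtx k + y • vtx (k + 1) := by
    intro k q hq
    obtain ⟨x, y, hx, hy, hxy, rfl⟩ := mem_triangle.1 hq
    refine ⟨(1 - x - y) + y * a k, x + y * b k, ?_, ?_, ?_, by module⟩
    · have := mul_nonneg hy (ha k); linarith
    · have := mul_nonneg hy (hb k); linarith
    · nlinarith [mul_nonneg hy (hab0 k)]
  have hsector : ∀ k, ∀ q ∈ T₀ k ∪ T₁ k, ∀ l : ZMod n, sideForm l q ≤ sideForm k q := by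
    rintro k q (hq | hq) l
    · obtain ⟨x, y, hx, hy, -, rfl⟩ := hform₀ k q hq
      exact sideForm_sector_le hn hx hy k l
    · obtain ⟨x, y, hx, hy, -, rfl⟩ := hform₁ k q hq
      exact sideForm_sector_le hn hx hy k l
  have hmeas₀ : ∀ k, MeasurableSet (T₀ k) := fun k => (isCompact_triangle _ _ _).measurableSet
  have hmeas₁ : ∀ k, MeasurableSet (T₁ k) := fun k => (isCompact_triangle _ _ _).measurableSet
  have hdisj : Pairwise (Function.onFun (AEDisjoint volume) fun k => T₀ k ∪ T₁ k) := by
    intro k l hkl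
    refine measure_mono_null ?_ (volume_setOf_linearMap_eq
      (sub_ne_zero.2 ((sideForm_injective hn).ne hkl)) 0)
    rintro q ⟨hk, hl⟩
    simp only [Set.mem_ofPred_eq, LinearMap.sub_apply]
    linarith [hsector k q hk l, hsector l q hl k]
  have hdisj' : ∀ k, AEDisjoint volume (T₀ k) (T₁ k) := by
    intro k
    have hne : (sideForm k : E2 →ₗ[ℝ] ℝ) ≠ 0 := fun h => by
      have := sideForm_vtx_self k
      rw [h, LinearMap.zero_apply] at this
      exact hc.ne this
    refine measure_mono_null ?_ (volume_setOf_linearMap_eq hne (cos (π / n)))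
    rintro q ⟨h₀, h₁⟩
    obtain ⟨x, y, -, -, hxy, rfl⟩ := hform₀ k q h₀
    obtain ⟨x', y', -, -, hxy', e⟩ := hform₁ k _ h₁
    have e' := congrArg (sideForm k) e
    simp only [Set.mem_ofPred_eq]
    simp only [map_add, map_smul, smul_eq_mul, sideForm_vtx_self, sideForm_vtx_add_one] at e' ⊢
    nlinarith
  have hvol : ∀ k, volume (T₀ k ∪ T₁ k) = ENNReal.ofReal (sin (2 * π / n) / 2 *
      (1 + 2 * (1 - cos (2 * π / n)) * h k)) := by
    intro k
    rw [measure_union₀ (hmeas₁ k).nullMeasurableSet (hdisj' k), volume_triangle_vtx k hn,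
      volume_outer_triangle hn k (hab0 k), hab, ← ENNReal.ofReal_add (by positivity)
        (mul_nonneg (by positivity) (mul_nonneg hκ (h0 k)))]
    congr 1
    ring
  calc ENNReal.ofReal (sin (2 * π / n) / 2 * (n + 2 * (1 - cos (2 * π / n)) * ∑ k, h k))
      = ∑ k, volume (T₀ k ∪ T₁ k) := by
        simp only [hvol]
        rw [← ENNReal.ofReal_sum_of_nonneg fun k _ => mul_nonneg (by positivity)
          (add_nonneg zero_le_one (mul_nonneg hκ (h0 k))), ← Finset.mul_sum,
          Finset.sum_add_distrib, ← Finset.mul_sum]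
        simp
    _ = volume (⋃ k, (T₀ k ∪ T₁ k)) := by
        rw [measure_iUnion₀ hdisj fun k => ((hmeas₀ k).union (hmeas₁ k)).nullMeasurableSet,
          tsum_fintype]
    _ ≤ volume Q := by
        refine measure_mono (Set.iUnion_subset fun k => Set.union_subset ?_ ?_)
        · exact hQ.triangle_subset hQ0 (by simpa using hV k) (by simpa using hV (k + 1))
        · refine hQ.triangle_subset (hV k) (by simpa using hV (k + 1)) ?_
          convert hA k using 1
          rw [hap]
          module

end Apex

variable [NeZero n]

theorem exists_polygon (hn : 5 ≤ n) (hmod : n % 4 = 1) : ∃ Q : Set E2, IsConvexPolygon Q ∧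
    (∀ k : ZMod n, vtx k ∈ Q) ∧ (∀ k : ZMod n, vtx k ∉ interior Q) ∧
    ENNReal.ofReal (areaMax n) ≤ volume Q := by
  classical
  obtain ⟨h, h0, hst, hsum⟩ := exists_stationary_heights hn hmod
  let F : Finset E2 := Finset.univ.image (vtx (n := n)) ∪ Finset.univ.image (apex h)
  have hV : ∀ k : ZMod n, vtx k ∈ convexHull ℝ (F : Set E2) := fun k =>
    subset_convexHull ℝ _ (by simp [F])
  have hA : ∀ k : ZMod n, apex h k ∈ convexHull ℝ (F : Set E2) := fun k =>
    subset_convexHull ℝ _ (by simp [F])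
  have hzero : (0 : E2) ∈ convexHull ℝ (F : Set E2) := by
    have := (convex_convexHull ℝ (F : Set E2)).sum_mem (t := Finset.univ)
      (w := fun _ : ZMod n => (n : ℝ)⁻¹) (fun _ _ => by positivity)
      (by simp [NeZero.ne n]) fun k _ => hV k
    rwa [← Finset.smul_sum, sum_vtx hn, smul_zero] at this
  refine ⟨convexHull ℝ (F : Set E2), ⟨F, rfl⟩, hV, fun m => ?_, ?_⟩
  · obtain ⟨f, hf0, hfV, hfA⟩ := exists_support h0 hst hn m
    refine notMem_interior_of_forall_le hf0 fun q hq => ?_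
    have hsub : (F : Set E2) ⊆ {q | f q ≤ f (vtx m)} := by
      intro q hq
      simp only [F, Finset.coe_union, Finset.coe_image, Finset.coe_univ, Set.image_univ,
        Set.mem_union, Set.mem_range] at hq
      rcases hq with ⟨j, rfl⟩ | ⟨j, rfl⟩
      · exact hfV j
      · exact hfA j
    exact convexHull_min hsub (convex_halfSpace_le f.isLinear _) hq
  · rw [areaMax, ← hsum]
    refine le_volume_of_apex_mem h0 hst hn (convex_convexHull ℝ _) hzero hV hA

end LowerBound

theorem stmt13 (n : ℕ) (hn : 5 ≤ n) (hmod : n % 4 = 1) :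
    maxCircArea n = n * tan (π / n) +
      (sin (π / n) ^ 4 / cos (π / n) ^ 2) *
        (((n : ℝ) + 3) / 4 * tan (2 * π / n) - tan (3 * π / (2 * n))) := by
  have : NeZero n := ⟨by omega⟩
  have hmem : ∀ Q : Set E2, regPoly n ⊆ Q → ∀ k : ZMod n, vtx k ∈ Q := fun Q hQ k =>
    hQ (subset_convexHull ℝ _ ⟨⟨k.val, ZMod.val_lt k⟩, rfl⟩)
  have harea : areaMax n = n * tan (π / n) +
      (sin (π / n) ^ 4 / cos (π / n) ^ 2) *
        (((n : ℝ) + 3) / 4 * tan (2 * π / n) - tan (3 * π / (2 * n))) := by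
    have hc := (cos_pi_div_pos hn).ne'
    have hs : cos (π / n) ^ 2 = 1 - sin (π / n) ^ 2 := cos_sq' _
    rw [areaMax, heightMax, mul_div_assoc 2 π (n : ℝ)]
    generalize tan (2 * (π / n)) = A
    generalize tan (3 * π / (2 * n)) = B
    rw [sin_two_mul, cos_two_mul, tan_eq_sin_div_cos]
    rw [show (2 : ℝ) * (1 - (2 * cos (π / n) ^ 2 - 1)) = 4 * sin (π / n) ^ 2 by rw [hs]; ring]
    generalize sin (π / n) = s at *
    generalize cos (π / n) = c at *
    field_simp
    linear_combination (4 * s * c * n) * hs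
  have harea0 : 0 ≤ areaMax n := by
    unfold areaMax
    have := (sin_two_pi_div_pos hn).le
    have : 0 ≤ 1 - cos (2 * π / n) := by linarith [cos_two_pi_div_lt_one hn]
    have := heightMax_nonneg hn hmod
    positivity
  rw [← harea]
  have hle : ∀ Q : Set E2, IsConvexPolygon Q → regPoly n ⊆ Q →
      (∀ k : Fin n, regVtx n k ∈ frontier Q) → volume Q ≤ ENNReal.ofReal (areaMax n) := by
    rintro Q ⟨F, rfl⟩ hQ hfr
    exact volume_le_areaMax hn hmod (convex_convexHull ℝ _) (hmem _ hQ)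
      fun k => (hfr ⟨k.val, ZMod.val_lt k⟩).2
  obtain ⟨Q, hQ, hV, hint, hvol⟩ := exists_polygon hn hmod
  have hvtx : ∀ k : Fin n, regVtx n k = vtx (k.val : ZMod n) := fun k => by
    rw [vtx, ZMod.val_natCast_of_lt k.isLt]
  have hsub : regPoly n ⊆ Q := by
    obtain ⟨F, rfl⟩ := hQ
    refine convexHull_min ?_ (convex_convexHull ℝ _)
    rintro _ ⟨k, rfl⟩
    beta_reduce
    rw [hvtx]
    exact hV _
  have hfr : ∀ k : Fin n, regVtx n k ∈ frontier Q := fun k => by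
    rw [hvtx]
    exact ⟨subset_closure (hV _), hint _⟩
  refine IsGreatest.csSup_eq ⟨⟨Q, hQ, hsub, hfr, ?_⟩, ?_⟩
  · rw [(hle Q hQ hsub hfr).antisymm hvol, ENNReal.toReal_ofReal harea0]
  · rintro _ ⟨Q', hQ', hsub', hfr', rfl⟩
    exact ENNReal.toReal_le_of_le_ofReal harea0 (hle Q' hQ' hsub' hfr')
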